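/- arXiv:0901.3565 — 3 statements merged into one kernel-verified Lean document; each statement's English description precedes it below -/
import Mathlib

section
/- Fix an integer ℓ > 2. Let λ and μ be partitions in the same regularization class. Then there exists an arrangement of μ from λ under which no locked box of λ moves down. -/
noncomputable section

/-!
Common combinatorial definitions: partitions (English notation, rows indexed from 1),
Young diagrams, hooks, rim hooks, ladders, residues, crystal operators (classical and
ladder versions), locked boxes, regularization classes, dominance order.
-/

structure YPartition where
  part : ℕ → ℕ
  zero_at_zero : part 0 = 0
  antitone : ∀ i j : ℕ, 1 ≤ i → i ≤ j → part j ≤ part i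
  eventually_zero : ∃ N : ℕ, ∀ i : ℕ, N ≤ i → part i = 0

namespace YPartition

/-- The set of boxes of the Young diagram of `μ` (row, column), both indices ≥ 1. -/
def cells (μ : YPartition) : Set (ℕ × ℕ) :=
  {p | 1 ≤ p.1 ∧ 1 ≤ p.2 ∧ p.2 ≤ μ.part p.1}

/-- The length of column `b`: the number of rows containing a box in column `b`. -/
def colLen (μ : YPartition) (b : ℕ) : ℕ :=
  Nat.card {a : ℕ | 1 ≤ a ∧ b ≤ μ.part a}

/-- The arm of box `(a,b)`: boxes strictly to its right in its row. -/
def arm (μ : YPartition) (a b : ℕ) : ℕ := μ.part a - b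

/-- The leg of box `(a,b)`: boxes strictly below it in its column. -/
def leg (μ : YPartition) (a b : ℕ) : ℕ := μ.colLen b - a

/-- The hook length of the box `(a,b)`: arm + leg + 1. -/
def hook (μ : YPartition) (a b : ℕ) : ℕ := (μ.part a - b) + (μ.colLen b - a) + 1

/-- The number of boxes of `μ`. -/
def size (μ : YPartition) : ℕ := μ.cells.ncard

/-- The number of (nonzero) parts of `μ`. -/
def length (μ : YPartition) : ℕ := μ.colLen 1

/-- `μ` is an `(ℓ,0)`-JM partition: there are no boxes `(a,b)`, `(a,y)`, `(x,b)` with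
`ℓ ∣ hook (a,b)` while `ℓ` divides neither `hook (a,y)` nor `hook (x,b)`. -/
def IsJM (ℓ : ℕ) (μ : YPartition) : Prop :=
  ¬ ∃ a b y x : ℕ, (a, b) ∈ μ.cells ∧ (a, y) ∈ μ.cells ∧ (x, b) ∈ μ.cells ∧
    ℓ ∣ μ.hook a b ∧ ¬ ℓ ∣ μ.hook a y ∧ ¬ ℓ ∣ μ.hook x b

/-- Two boxes share an edge. -/
def BoxAdjacent (p q : ℕ × ℕ) : Prop :=
  (p.1 = q.1 ∧ (p.2 + 1 = q.2 ∨ q.2 + 1 = p.2)) ∨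
  (p.2 = q.2 ∧ (p.1 + 1 = q.1 ∨ q.1 + 1 = p.1))

/-- A set of boxes is connected (via shared edges, inside the set). -/
def SetConnected (S : Set (ℕ × ℕ)) : Prop :=
  ∀ p ∈ S, ∀ q ∈ S,
    Relation.ReflTransGen (fun x y => x ∈ S ∧ y ∈ S ∧ BoxAdjacent x y) p q

/-- `S` contains no 2 × 2 square of boxes. -/
def HasNoSquare (S : Set (ℕ × ℕ)) : Prop :=
  ¬ ∃ a b : ℕ, (a, b) ∈ S ∧ (a + 1, b) ∈ S ∧ (a, b + 1) ∈ S ∧ (a + 1, b + 1) ∈ S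

/-- `S` is a removable `ℓ`-rim hook of `μ`: a connected set of `ℓ` boxes of `μ` with no
2 × 2 square whose removal leaves the Young diagram of a partition. -/
def IsRimHook (ℓ : ℕ) (μ : YPartition) (S : Set (ℕ × ℕ)) : Prop :=
  S ⊆ μ.cells ∧ S.ncard = ℓ ∧ SetConnected S ∧ HasNoSquare S ∧
    ∃ ν : YPartition, ν.cells = μ.cells \ S

/-- `S` is contained in a single row. -/
def HorizontalHook (S : Set (ℕ × ℕ)) : Prop := ∃ a : ℕ, ∀ p ∈ S, p.1 = a

/-- `S` is contained in a single column. -/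
def VerticalHook (S : Set (ℕ × ℕ)) : Prop := ∃ b : ℕ, ∀ p ∈ S, p.2 = b

/-- Two sets of boxes are adjacent when some box of one shares an edge with a box of the other. -/
def SetsAdjacent (R S : Set (ℕ × ℕ)) : Prop := ∃ p ∈ R, ∃ q ∈ S, BoxAdjacent p q

/-- An `ℓ`-core: a partition with no removable `ℓ`-rim hook. -/
def IsCore (ℓ : ℕ) (μ : YPartition) : Prop := ¬ ∃ S : Set (ℕ × ℕ), IsRimHook ℓ μ S

/-- `p` and `q` lie on the same ladder: going down one column step the row increases
by `ℓ - 1`. -/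
def SameLadder (ℓ : ℕ) (p q : ℕ × ℕ) : Prop :=
  (q.1 : ℤ) - (p.1 : ℤ) = ((ℓ : ℤ) - 1) * ((p.2 : ℤ) - (q.2 : ℤ))

/-- The index of the ladder through `p`: the ladder through `(k,1)` has index `k`. -/
def ladderIdx (ℓ : ℕ) (p : ℕ × ℕ) : ℕ := p.1 + (ℓ - 1) * (p.2 - 1)

/-- The residue of position `(a,b)` is `b - a` mod `ℓ`. -/
def res (ℓ : ℕ) (p : ℕ × ℕ) : ℕ := (((p.2 : ℤ) - (p.1 : ℤ)) % (ℓ : ℤ)).toNat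

/-- `p` is a removable box of `μ`. -/
def Removable (μ : YPartition) (p : ℕ × ℕ) : Prop :=
  1 ≤ p.1 ∧ p.2 = μ.part p.1 ∧ μ.part (p.1 + 1) < p.2

/-- `p` is an addable box of `μ`. -/
def Addable (μ : YPartition) (p : ℕ × ℕ) : Prop :=
  1 ≤ p.1 ∧ p.2 = μ.part p.1 + 1 ∧ (p.1 = 1 ∨ p.2 ≤ μ.part (p.1 - 1))

/-- The removable `i`-boxes of `μ`. -/
def RemovableRes (ℓ i : ℕ) (μ : YPartition) : Set (ℕ × ℕ) :=
  {p | Removable μ p ∧ res ℓ p = i}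

/-- The addable `i`-boxes of `μ`. -/
def AddableRes (ℓ i : ℕ) (μ : YPartition) : Set (ℕ × ℕ) :=
  {p | Addable μ p ∧ res ℓ p = i}

/-- Ladder reading order (reflexive): ladders left to right, top to bottom within a ladder.
`LadderLE ℓ p q` means `p` is read before (or equal to) `q`. -/
def LadderLE (ℓ : ℕ) (p q : ℕ × ℕ) : Prop :=
  ladderIdx ℓ p < ladderIdx ℓ q ∨ (ladderIdx ℓ p = ladderIdx ℓ q ∧ p.1 ≤ q.1)

/-- Strict ladder reading order. -/
def LadderLT (ℓ : ℕ) (p q : ℕ × ℕ) : Prop :=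
  ladderIdx ℓ p < ladderIdx ℓ q ∨ (ladderIdx ℓ p = ladderIdx ℓ q ∧ p.1 < q.1)

/-- Classical reading order (reflexive): rows from bottom to top.
`RowLE p q` means `p` is read before (or equal to) `q`. -/
def RowLE (p q : ℕ × ℕ) : Prop := q.1 ≤ p.1

/-- Given a reading order `le`, a set `Rem` of `-` marks and `Add` of `+` marks, a `-` at `p`
survives the cancellation of adjacent `-+` pairs iff every interval of the reading word
starting at `p` contains strictly more `-`'s than `+`'s. -/
def NormalIn (le : ℕ × ℕ → ℕ × ℕ → Prop) (Rem Add : Set (ℕ × ℕ)) (p : ℕ × ℕ) : Prop :=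
  p ∈ Rem ∧ ∀ q ∈ Rem ∪ Add, le p q →
    (Add ∩ {s | le p s ∧ le s q}).ncard < (Rem ∩ {s | le p s ∧ le s q}).ncard

/-- A `+` at `q` survives the cancellation of adjacent `-+` pairs iff every interval of the
reading word ending at `q` contains strictly more `+`'s than `-`'s. -/
def ConormalIn (le : ℕ × ℕ → ℕ × ℕ → Prop) (Rem Add : Set (ℕ × ℕ)) (q : ℕ × ℕ) : Prop :=
  q ∈ Add ∧ ∀ p ∈ Rem ∪ Add, le p q →
    (Rem ∩ {s | le p s ∧ le s q}).ncard < (Add ∩ {s | le p s ∧ le s q}).ncard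

/-- Ladder normal `i`-box. -/
def LadderNormal (ℓ i : ℕ) (μ : YPartition) (p : ℕ × ℕ) : Prop :=
  NormalIn (LadderLE ℓ) (RemovableRes ℓ i μ) (AddableRes ℓ i μ) p

/-- Ladder conormal `i`-box. -/
def LadderConormal (ℓ i : ℕ) (μ : YPartition) (p : ℕ × ℕ) : Prop :=
  ConormalIn (LadderLE ℓ) (RemovableRes ℓ i μ) (AddableRes ℓ i μ) p

/-- Normal `i`-box (classical signature). -/
def ClassNormal (ℓ i : ℕ) (μ : YPartition) (p : ℕ × ℕ) : Prop :=
  NormalIn RowLE (RemovableRes ℓ i μ) (AddableRes ℓ i μ) p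

/-- Conormal `i`-box (classical signature). -/
def ClassConormal (ℓ i : ℕ) (μ : YPartition) (p : ℕ × ℕ) : Prop :=
  ConormalIn RowLE (RemovableRes ℓ i μ) (AddableRes ℓ i μ) p

/-- `ε̂_i(μ)`: number of ladder normal `i`-boxes. -/
def hatEps (ℓ i : ℕ) (μ : YPartition) : ℕ := {p | LadderNormal ℓ i μ p}.ncard

/-- `φ̂_i(μ)`: number of ladder conormal `i`-boxes. -/
def hatPhi (ℓ i : ℕ) (μ : YPartition) : ℕ := {p | LadderConormal ℓ i μ p}.ncard

/-- `ε_i(μ)`: number of normal `i`-boxes. -/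
def eps (ℓ i : ℕ) (μ : YPartition) : ℕ := {p | ClassNormal ℓ i μ p}.ncard

/-- `φ_i(μ)`: number of conormal `i`-boxes. -/
def phi (ℓ i : ℕ) (μ : YPartition) : ℕ := {p | ClassConormal ℓ i μ p}.ncard

/-- The ladder good `i`-box: the leftmost `-` of the reduced ladder `i`-signature. -/
def LadderGood (ℓ i : ℕ) (μ : YPartition) (p : ℕ × ℕ) : Prop :=
  LadderNormal ℓ i μ p ∧ ∀ q, LadderNormal ℓ i μ q → LadderLE ℓ p q

/-- The ladder cogood `i`-box: the rightmost `+` of the reduced ladder `i`-signature. -/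
def LadderCogood (ℓ i : ℕ) (μ : YPartition) (p : ℕ × ℕ) : Prop :=
  LadderConormal ℓ i μ p ∧ ∀ q, LadderConormal ℓ i μ q → LadderLE ℓ q p

/-- The good `i`-box (classical). -/
def ClassGood (ℓ i : ℕ) (μ : YPartition) (p : ℕ × ℕ) : Prop :=
  ClassNormal ℓ i μ p ∧ ∀ q, ClassNormal ℓ i μ q → RowLE p q

/-- The cogood `i`-box (classical). -/
def ClassCogood (ℓ i : ℕ) (μ : YPartition) (p : ℕ × ℕ) : Prop :=
  ClassConormal ℓ i μ p ∧ ∀ q, ClassConormal ℓ i μ q → RowLE q p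

/-- The ladder crystal operator `f̂_i` as a relation: `mu = f̂_i lam ≠ 0`. -/
def HatF (ℓ i : ℕ) (lam mu : YPartition) : Prop :=
  ∃ p, LadderCogood ℓ i lam p ∧ mu.cells = insert p lam.cells

/-- The ladder crystal operator `ê_i` as a relation: `mu = ê_i lam ≠ 0`. -/
def HatE (ℓ i : ℕ) (lam mu : YPartition) : Prop :=
  ∃ p, LadderGood ℓ i lam p ∧ mu.cells = lam.cells \ {p}

/-- The classical crystal operator `f̃_i` as a relation: `mu = f̃_i lam ≠ 0`. -/
def TildeF (ℓ i : ℕ) (lam mu : YPartition) : Prop :=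
  ∃ p, ClassCogood ℓ i lam p ∧ mu.cells = insert p lam.cells

/-- The classical crystal operator `ẽ_i` as a relation: `mu = ẽ_i lam ≠ 0`. -/
def TildeE (ℓ i : ℕ) (lam mu : YPartition) : Prop :=
  ∃ p, ClassGood ℓ i lam p ∧ mu.cells = lam.cells \ {p}

/-- `n`-fold composition of a relation. -/
def RelIter {α : Type} (r : α → α → Prop) : ℕ → α → α → Prop
  | 0 => fun a b => a = b
  | n + 1 => fun a b => ∃ c, r a c ∧ RelIter r n c b

/-- The empty partition. -/
def emptyP : YPartition where
  part := fun _ => 0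
  zero_at_zero := rfl
  antitone := fun _ _ _ _ => le_rfl
  eventually_zero := ⟨0, fun _ _ => rfl⟩

/-- `μ` is a node of the ladder crystal `B(Λ₀)^L`: it is obtained from the empty
partition by finitely many applications of the operators `f̂_i`, `0 ≤ i < ℓ`. -/
def LadderNode (ℓ : ℕ) (μ : YPartition) : Prop :=
  Relation.ReflTransGen (fun a b => ∃ i : ℕ, i < ℓ ∧ HatF ℓ i a b) emptyP μ

/-- The type I locking condition at `(a,b)`: every unoccupied position on the ladder of
`(a,b)` lying below it has an unoccupied position directly above it. -/
def LadderClear (ℓ : ℕ) (μ : YPartition) (a b : ℕ) : Prop :=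
  ∀ c d : ℕ, 1 ≤ c → 1 ≤ d → SameLadder ℓ (a, b) (c, d) → a < c →
    (c, d) ∉ μ.cells → (c - 1, d) ∉ μ.cells

/-- Locked boxes of `μ`. -/
inductive Locked (ℓ : ℕ) (μ : YPartition) : ℕ × ℕ → Prop where
  | typeI_top : ∀ b : ℕ, (1, b) ∈ μ.cells → LadderClear ℓ μ 1 b → Locked ℓ μ (1, b)
  | typeI_up : ∀ a b : ℕ, (a + 1, b) ∈ μ.cells → Locked ℓ μ (a, b) →
      LadderClear ℓ μ (a + 1) b → Locked ℓ μ (a + 1, b)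
  | typeII : ∀ a b b' : ℕ, (a, b) ∈ μ.cells → b < b' → Locked ℓ μ (a, b') → Locked ℓ μ (a, b)

/-- Number of boxes of `μ` on the `k`-th ladder. -/
def ladderCount (ℓ : ℕ) (μ : YPartition) (k : ℕ) : ℕ :=
  (μ.cells ∩ {p | ladderIdx ℓ p = k}).ncard

/-- `lam` and `mu` lie in the same regularization class: they have the same number of
boxes on every ladder. -/
def SameRegClass (ℓ : ℕ) (lam mu : YPartition) : Prop :=
  ∀ k : ℕ, ladderCount ℓ lam k = ladderCount ℓ mu k

/-- The boxes of `μ` are top-justified on each ladder. -/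
def TopJustified (ℓ : ℕ) (μ : YPartition) : Prop :=
  ∀ p ∈ μ.cells, ∀ q : ℕ × ℕ, 1 ≤ q.1 → 1 ≤ q.2 →
    ladderIdx ℓ q = ladderIdx ℓ p → q.1 < p.1 → q ∈ μ.cells

/-- `mu = R lam`: the regularization of `lam`, obtained by moving every box of `lam` to
the topmost unoccupied positions of its ladder. -/
def IsRegularization (ℓ : ℕ) (lam mu : YPartition) : Prop :=
  SameRegClass ℓ lam mu ∧ TopJustified ℓ mu

/-- Dominance order on partitions. -/
def DomLE (lam mu : YPartition) : Prop :=
  ∀ j : ℕ, ∑ i ∈ Finset.Icc 1 j, lam.part i ≤ ∑ i ∈ Finset.Icc 1 j, mu.part i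

/-- All (positive) positions on the `k`-th ladder. -/
def LadderPositions (ℓ k : ℕ) : Set (ℕ × ℕ) :=
  {p | 1 ≤ p.1 ∧ 1 ≤ p.2 ∧ ladderIdx ℓ p = k}

/-- The set of locked boxes of `μ`. -/
def lockedCells (ℓ : ℕ) (μ : YPartition) : Set (ℕ × ℕ) := {p | Locked ℓ μ p}

/-- The number of unlocked boxes of `μ` on the `k`-th ladder. -/
def unlockedCount (ℓ : ℕ) (μ : YPartition) (k : ℕ) : ℕ :=
  ((μ.cells ∩ LadderPositions ℓ k) \ lockedCells ℓ μ).ncard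

/-- The diagram `S μ`: locked boxes stay put, and on each ladder the unlocked boxes are
moved into the lowest positions of that ladder not occupied by locked boxes. -/
def SCells (ℓ : ℕ) (μ : YPartition) : Set (ℕ × ℕ) :=
  lockedCells ℓ μ ∪
    {p | 1 ≤ p.1 ∧ 1 ≤ p.2 ∧ p ∉ lockedCells ℓ μ ∧
      ((LadderPositions ℓ (ladderIdx ℓ p) ∩ {q | p.1 < q.1}) \ lockedCells ℓ μ).ncard
        < unlockedCount ℓ μ (ladderIdx ℓ p)}

/-- `μ` is `ℓ`-regular: no part occurs `ℓ` or more times. -/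
def IsRegular (ℓ : ℕ) (μ : YPartition) : Prop :=
  ∀ a : ℕ, 1 ≤ a → 0 < μ.part (a + (ℓ - 1)) → μ.part (a + (ℓ - 1)) < μ.part a

/-- Removal of a single horizontal or vertical `ℓ`-rim hook. -/
def RemoveHV (ℓ : ℕ) (lam mu : YPartition) : Prop :=
  ∃ S : Set (ℕ × ℕ), IsRimHook ℓ lam S ∧ (HorizontalHook S ∨ VerticalHook S) ∧
    mu.cells = lam.cells \ S

/-- Condition (1): every removable `ℓ`-rim hook is horizontal or vertical. -/
def Cond1 (ℓ : ℕ) (μ : YPartition) : Prop :=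
  ∀ S : Set (ℕ × ℕ), IsRimHook ℓ μ S → HorizontalHook S ∨ VerticalHook S

/-- Condition (2): no vertical (resp. horizontal) `ℓ`-rim hook `R` of `μ` together with an
adjacent horizontal (resp. vertical) `ℓ`-rim hook `S` of `μ \ R` . -/
def Cond2 (ℓ : ℕ) (μ : YPartition) : Prop :=
  ¬ ∃ (R S : Set (ℕ × ℕ)) (ν : YPartition), IsRimHook ℓ μ R ∧ ν.cells = μ.cells \ R ∧
    IsRimHook ℓ ν S ∧ SetsAdjacent R S ∧
    ((VerticalHook R ∧ HorizontalHook S) ∨ (HorizontalHook R ∧ VerticalHook S))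

/-- A generalized `ℓ`-partition: conditions (1) and (2) hold after removing any sequence of
horizontal and vertical `ℓ`-rim hooks (including the empty sequence). -/
def IsGenLPartition (ℓ : ℕ) (lam : YPartition) : Prop :=
  ∀ mu : YPartition, Relation.ReflTransGen (RemoveHV ℓ) lam mu → Cond1 ℓ mu ∧ Cond2 ℓ mu

/-- The `t`-th row (from the top) of the bottom block of the decomposition
`(μ, r, s, ρ, σ)`: the number of values `v ∈ [1, s+1]` whose column block still reaches
row `t`; column block `v` consists of `σ_v·ℓ + (s+1−v)(ℓ−1)` rows of length `≥ v`. -/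
def bottomPart (ℓ s : ℕ) (σ : YPartition) (t : ℕ) : ℕ :=
  ((Finset.Icc 1 (s + 1)).filter fun v => t ≤ σ.part v * ℓ + (s + 1 - v) * (ℓ - 1)).card

/-- The `i`-th part of the partition corresponding to the data `(μ, r, s, ρ, σ)`. -/
def decompPart (ℓ : ℕ) (mu : YPartition) (r s : ℕ) (ρ σ : YPartition) (i : ℕ) : ℕ :=
  if i = 0 then 0
  else if i ≤ r + 1 then s + mu.part 1 + (r + 1 - i) * (ℓ - 1) + ρ.part i * ℓ
  else if i ≤ r + max mu.length 1 then s + mu.part (i - r)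
  else bottomPart ℓ s σ (i - (r + max mu.length 1))

/-- Admissibility of the decomposition data `(μ, r, s, ρ, σ)`. -/
def GoodData (ℓ : ℕ) (mu : YPartition) (r s : ℕ) (ρ σ : YPartition) : Prop :=
  IsCore ℓ mu ∧ mu.part 1 < mu.part 2 + (ℓ - 1) ∧ mu.colLen 1 < mu.colLen 2 + (ℓ - 1) ∧
  ρ.length ≤ r + 1 ∧ σ.length ≤ s + 1 ∧
  (mu.cells = ∅ → ρ.part (r + 1) = 0 ∨ σ.part (s + 1) = 0)

/-- `lam ≈ (μ, r, s, ρ, σ)`. -/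
def Decomposes (ℓ : ℕ) (lam mu : YPartition) (r s : ℕ) (ρ σ : YPartition) : Prop :=
  ∀ i : ℕ, lam.part i = decompPart ℓ mu r s ρ σ i

/-- Removal of a single `ℓ`-rim hook. -/
def RemoveHook (ℓ : ℕ) (lam mu : YPartition) : Prop :=
  ∃ S : Set (ℕ × ℕ), IsRimHook ℓ lam S ∧ mu.cells = lam.cells \ S

/-- `lam` has `ℓ`-core `nu` and `ℓ`-weight `w`. -/
def HasCoreAndWeight (ℓ : ℕ) (lam nu : YPartition) (w : ℕ) : Prop :=
  IsCore ℓ nu ∧ RelIter (RemoveHook ℓ) w lam nu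

/-- An L-partition. -/
def IsLPartition (ℓ : ℕ) (lam : YPartition) : Prop :=
  ¬ ∃ p : ℕ × ℕ, p ∈ lam.cells ∧ ℓ ∣ lam.hook p.1 p.2 ∧
    (lam.arm p.1 p.2 < (ℓ - 1) * lam.leg p.1 p.2 ∨
     lam.leg p.1 p.2 < (ℓ - 1) * lam.arm p.1 p.2)

end YPartition

open YPartition
section Helpers

open Classical

theorem aux_count_le {p q : ℕ → Prop} {n : ℕ} (h : ∀ r < n, p r → q r) :
    Nat.count p n ≤ Nat.count q n := by
  rw [Nat.count_eq_card_filter_range, Nat.count_eq_card_filter_range]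
  apply Finset.card_le_card
  intro r hr
  simp only [Finset.mem_filter, Finset.mem_range] at hr ⊢
  exact ⟨hr.1, h r hr.1 hr.2⟩

theorem aux_nth {p : ℕ → Prop} {n N : ℕ} (h : n < Nat.count p N) :
    p (Nat.nth p n) ∧ Nat.count p (Nat.nth p n) = n := by
  have key : ∀ hf : (Set.ofPred p).Finite, n < hf.toFinset.card := by
    intro hf
    refine lt_of_lt_of_le h ?_
    rw [Nat.count_eq_card_filter_range]
    apply Finset.card_le_card
    intro r hr
    simp only [Finset.mem_filter, Finset.mem_range] at hr
    rw [Set.Finite.mem_toFinset]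
    exact hr.2
  exact ⟨Nat.nth_mem n key, Nat.count_nth key⟩

/-- Row `r` of `P` has a box on the `k`-th ladder. -/
def RowOn (ℓ : ℕ) (P : YPartition) (k r : ℕ) : Prop :=
  ∃ d, (r, d) ∈ P.cells ∧ ladderIdx ℓ (r, d) = k

theorem aux_lt_of_rowOn {ℓ : ℕ} {P : YPartition} {k r : ℕ} (h : RowOn ℓ P k r) :
    r < k + 1 := by
  obtain ⟨d, _, h⟩ := h
  simp only [ladderIdx] at h
  omega

theorem aux_ladderCount (ℓ : ℕ) (hℓ : 2 < ℓ) (P : YPartition) (k : ℕ) :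
    ladderCount ℓ P k = Nat.count (RowOn ℓ P k) (k + 1) := by
  rw [ladderCount, Nat.count_eq_card_filter_range, ← Set.ncard_coe_finset]
  have himg : ((Finset.filter (RowOn ℓ P k) (Finset.range (k + 1)) : Finset ℕ) : Set ℕ)
      = Prod.fst '' (P.cells ∩ {p | ladderIdx ℓ p = k}) := by
    ext r
    constructor
    · intro hr
      simp only [Finset.coe_filter, Set.mem_ofPred_eq] at hr
      obtain ⟨d, h1, h2⟩ := hr.2
      exact ⟨(r, d), ⟨h1, h2⟩, rfl⟩
    · rintro ⟨⟨a, d⟩, ⟨h1, h2⟩, rfl⟩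
      have : RowOn ℓ P k a := ⟨d, h1, h2⟩
      simp only [Finset.coe_filter, Set.mem_ofPred_eq, Finset.mem_range]
      exact ⟨aux_lt_of_rowOn this, this⟩
  rw [himg, Set.InjOn.ncard_image]
  rintro ⟨a, b⟩ ⟨h1, h2⟩ ⟨a', b'⟩ ⟨h3, h4⟩ heq
  simp only [cells, Set.mem_ofPred_eq, ladderIdx] at h1 h2 h3 h4 heq
  subst heq
  have : (ℓ - 1) * (b - 1) = (ℓ - 1) * (b' - 1) := by omega
  have := Nat.eq_of_mul_eq_mul_left (by omega) this
  ext <;> simp; omega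

theorem aux_cells_up {P : YPartition} {a a' b b' : ℕ} (h : (a, b) ∈ P.cells) (ha : 1 ≤ a')
    (haa : a' ≤ a) (hb : 1 ≤ b') (hbb : b' ≤ b) : (a', b') ∈ P.cells := by
  simp only [cells, Set.mem_ofPred_eq] at h ⊢
  have := P.antitone a' a ha haa
  omega

theorem aux_locked_mem {ℓ : ℕ} {P : YPartition} {p : ℕ × ℕ} (h : Locked ℓ P p) :
    p ∈ P.cells := by
  cases h <;> assumption

theorem aux_locked_up1 {ℓ : ℕ} {P : YPartition} {p : ℕ × ℕ} (h : Locked ℓ P p) :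
    ∀ a, 1 ≤ a → p.1 = a + 1 → Locked ℓ P (a, p.2) := by
  induction h with
  | typeI_top b _ _ => intro a ha h; simp at h; omega
  | typeI_up a' b _ h _ _ =>
    intro a ha h'
    simp only [Nat.add_right_cancel_iff] at h'
    subst h'; exact h
  | typeII a' b b' hm hb _ ih =>
    intro a ha h'
    simp only at h'
    subst h'
    refine Locked.typeII a b b' ?_ hb (ih a ha rfl)
    exact aux_cells_up hm ha (by omega) hm.2.1 le_rfl

theorem aux_locked_up {ℓ : ℕ} {P : YPartition} {a b : ℕ} (n : ℕ) (ha : 1 ≤ a)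
    (h : Locked ℓ P (a + n, b)) : Locked ℓ P (a, b) := by
  induction n with
  | zero => exact h
  | succ n ih => exact ih (aux_locked_up1 h (a + n) (by omega) rfl)

theorem aux_right {ℓ : ℕ} {P : YPartition} {a b : ℕ} (h : Locked ℓ P (a, b))
    (hc : ¬ LadderClear ℓ P a b) : Locked ℓ P (a, b + 1) := by
  cases h with
  | typeI_top _ _ h => exact absurd h hc
  | typeI_up _ _ _ _ h => exact absurd h hc
  | typeII _ _ b' hm hb h =>
    rcases Nat.lt_or_ge (b + 1) b' with h1 | h1
    · refine Locked.typeII a (b + 1) b' ?_ h1 h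
      exact aux_cells_up (aux_locked_mem h) hm.1 le_rfl (by omega) h1.le
    · have : b' = b + 1 := by omega
      subst this; exact h

theorem aux_clear_down {ℓ : ℕ} (hℓ : 2 < ℓ) {P : YPartition} {a b : ℕ}
    (h : LadderClear ℓ P a (b + 1)) : LadderClear ℓ P (a + (ℓ - 1)) b := by
  intro c d hc hd hs hac
  refine h c d hc hd ?_ (by omega)
  simp only [SameLadder] at hs ⊢
  push_cast [Nat.cast_sub (show 1 ≤ ℓ by omega)] at hs ⊢
  linarith

theorem aux_chain {ℓ : ℕ} (hℓ : 2 < ℓ) {P : YPartition} {b : ℕ} (j : ℕ) :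
    ∀ a, 1 ≤ a → Locked ℓ P (a + (ℓ - 1) * j, b) → ¬ LadderClear ℓ P (a + (ℓ - 1) * j) b →
      Locked ℓ P (a, b + j) ∧ ¬ LadderClear ℓ P a (b + j) := by
  induction j with
  | zero => intro a _ h1 h2; exact ⟨by simpa using h1, by simpa using h2⟩
  | succ j ih =>
    intro a ha h1 h2
    have e : a + (ℓ - 1) * (j + 1) = (a + (ℓ - 1)) + (ℓ - 1) * j := by ring
    rw [e] at h1 h2
    obtain ⟨h3, h4⟩ := ih (a + (ℓ - 1)) (by omega) h1 h2
    exact ⟨aux_locked_up _ ha (aux_right h3 h4), fun h => h4 (aux_clear_down hℓ h)⟩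

theorem aux_clear_case {ℓ : ℕ} (hℓ : 2 < ℓ) {lam mu : YPartition}
    (hrc : SameRegClass ℓ lam mu) {a b k : ℕ} (hb : 1 ≤ b)
    (hk : ladderIdx ℓ (a + 1, b) = k + 1) (hc : LadderClear ℓ lam (a + 1) b)
    (ih : Nat.count (RowOn ℓ lam k) (a + 1) ≤ Nat.count (RowOn ℓ mu k) (a + 1)) :
    Nat.count (RowOn ℓ lam (k + 1)) (a + 2) ≤ Nat.count (RowOn ℓ mu (k + 1)) (a + 2) := by
  have h1 := hrc k
  have h2 := hrc (k + 1)
  rw [aux_ladderCount ℓ hℓ, aux_ladderCount ℓ hℓ] at h1 h2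
  have hak : a ≤ k := by simp only [ladderIdx] at hk; omega
  obtain ⟨t, rfl⟩ := Nat.exists_eq_add_of_le hak
  rw [show a + t + 1 = (a + 1) + t by ring, Nat.count_add _ (a + 1) t, Nat.count_add _ (a + 1) t] at h1
  rw [show a + t + 1 + 1 = (a + 2) + t by ring, Nat.count_add _ (a + 2) t, Nat.count_add _ (a + 2) t] at h2
  have h3 : Nat.count (fun i => RowOn ℓ lam (a + t) (a + 1 + i)) t ≤
      Nat.count (fun i => RowOn ℓ lam (a + t + 1) (a + 2 + i)) t := by
    apply aux_count_le
    rintro i - ⟨d, hd, hi⟩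
    by_contra hcon
    have hi' : ladderIdx ℓ (a + 2 + i, d) = a + t + 1 := by
      simp only [ladderIdx] at hi ⊢; omega
    have hn : (a + 2 + i, d) ∉ lam.cells := fun h => hcon ⟨d, h, hi'⟩
    refine hc (a + 2 + i) d (by omega) hd.2.1 ?_ (by omega) hn ?_
    · rw [← hi'] at hk
      have hd1 := hd.2.1
      simp only [ladderIdx, SameLadder] at hk hd1 ⊢
      zify [hb, hd1, (show 1 ≤ ℓ by omega)] at hk
      push_cast
      linarith
    · rwa [show a + 2 + i - 1 = a + 1 + i by omega]
  have h4 : Nat.count (fun i => RowOn ℓ mu (a + t + 1) (a + 2 + i)) t ≤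
      Nat.count (fun i => RowOn ℓ mu (a + t) (a + 1 + i)) t := by
    apply aux_count_le
    rintro i - ⟨d, hd, hi⟩
    refine ⟨d, aux_cells_up hd (by omega) (by omega) hd.2.1 le_rfl, ?_⟩
    simp only [ladderIdx] at hi ⊢; omega
  have h2' : Nat.count (RowOn ℓ lam (a + t + 1)) (a + 2) +
      Nat.count (fun i => RowOn ℓ lam (a + t + 1) (a + 2 + i)) t =
      Nat.count (RowOn ℓ mu (a + t + 1)) (a + 2) +
      Nat.count (fun i => RowOn ℓ mu (a + t + 1) (a + 2 + i)) t := h2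
  have h1' : Nat.count (RowOn ℓ lam (a + t)) (a + 1) +
      Nat.count (fun i => RowOn ℓ lam (a + t) (a + 1 + i)) t =
      Nat.count (RowOn ℓ mu (a + t)) (a + 1) +
      Nat.count (fun i => RowOn ℓ mu (a + t) (a + 1 + i)) t := h1
  omega

theorem aux_step {ℓ : ℕ} (hℓ : 2 < ℓ) {lam mu : YPartition} (hrc : SameRegClass ℓ lam mu)
    {a b : ℕ} (h : Locked ℓ lam (a + 1, b))
    (hup : 1 ≤ a → Nat.count (RowOn ℓ lam (ladderIdx ℓ (a, b))) (a + 1) ≤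
        Nat.count (RowOn ℓ mu (ladderIdx ℓ (a, b))) (a + 1))
    (hright : Locked ℓ lam (a + 1, b + 1) →
      Nat.count (RowOn ℓ lam (ladderIdx ℓ (a + 1, b + 1))) (a + 2) ≤
        Nat.count (RowOn ℓ mu (ladderIdx ℓ (a + 1, b + 1))) (a + 2)) :
    Nat.count (RowOn ℓ lam (ladderIdx ℓ (a + 1, b))) (a + 2) ≤
        Nat.count (RowOn ℓ mu (ladderIdx ℓ (a + 1, b))) (a + 2) := by
  have hb : 1 ≤ b := (aux_locked_mem h).2.1
  by_cases hc : LadderClear ℓ lam (a + 1) b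
  · have hk : ladderIdx ℓ (a + 1, b) = ladderIdx ℓ (a, b) + 1 := by
      simp only [ladderIdx]; ring
    rw [hk]
    refine aux_clear_case hℓ hrc hb hk hc ?_
    rcases Nat.eq_zero_or_pos a with rfl | ha
    · have : ∀ k, ¬ RowOn ℓ lam k 0 := by
        rintro k ⟨d, hd, -⟩
        exact absurd hd.1 (by simp)
      simp [Nat.count_succ, this]
    · exact hup ha
  · refine le_trans ?_ (le_trans (hright (aux_right h hc)) ?_)
    · apply aux_count_le
      rintro r hr ⟨d, hd, hi⟩
      have hd1 := hd.2.1
      have hr1 := hd.1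
      simp only at hd1 hr1
      have hdb : b ≤ d := by
        by_contra hlt
        simp only [ladderIdx] at hi
        have : (ℓ - 1) * (d - 1) + (ℓ - 1) ≤ (ℓ - 1) * (b - 1) := by
          rw [show (ℓ - 1) * (d - 1) + (ℓ - 1) = (ℓ - 1) * d by
            obtain ⟨e, rfl⟩ := Nat.exists_eq_add_of_le hd1
            simp; ring]
          exact Nat.mul_le_mul_left _ (by omega)
        omega
      obtain ⟨j, rfl⟩ := Nat.exists_eq_add_of_le hdb
      have hra : a + 1 = r + (ℓ - 1) * j := by
        simp only [ladderIdx] at hi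
        rw [show b + j - 1 = (b - 1) + j by omega, Nat.mul_add] at hi
        omega
      rw [hra] at h hc
      obtain ⟨h3, h4⟩ := aux_chain hℓ j r hr1 h hc
      refine ⟨b + j + 1, aux_locked_mem (aux_right h3 h4), ?_⟩
      simp only [ladderIdx] at hi ⊢
      rw [show b + j + 1 - 1 = (b + j - 1) + 1 by omega,
        show b + 1 - 1 = (b - 1) + 1 by omega, Nat.mul_add, Nat.mul_add]
      omega
    · apply aux_count_le
      rintro r hr ⟨d, hd, hi⟩
      have hd1 := hd.2.1
      simp only at hd1
      simp only [ladderIdx] at hi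
      rw [show b + 1 - 1 = (b - 1) + 1 by omega, Nat.mul_add] at hi
      have hd2 : 2 ≤ d := by
        by_contra hlt
        have : d = 1 := by omega
        subst this
        simp at hi
        omega
      refine ⟨d - 1, aux_cells_up hd hd.1 le_rfl (by omega) (by omega), ?_⟩
      simp only [ladderIdx]
      rw [show d - 1 = (d - 1 - 1) + 1 by omega, Nat.mul_add] at hi
      omega

theorem aux_main {ℓ : ℕ} (hℓ : 2 < ℓ) {lam mu : YPartition} (hrc : SameRegClass ℓ lam mu)
    (a : ℕ) : ∀ n b, lam.part 1 - b ≤ n → Locked ℓ lam (a + 1, b) →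
      Nat.count (RowOn ℓ lam (ladderIdx ℓ (a + 1, b))) (a + 2) ≤
        Nat.count (RowOn ℓ mu (ladderIdx ℓ (a + 1, b))) (a + 2) := by
  -- the lexicographic induction: rows from the top, then columns from the right
  induction a with
  | zero =>
    intro n
    induction n with
    | zero =>
      intro b hn h
      refine aux_step hℓ hrc h (fun h' => by omega) (fun h' => ?_)
      have := (aux_locked_mem h').2.2
      simp at this; omega
    | succ n ihn =>
      intro b hn h
      exact aux_step hℓ hrc h (fun h' => by omega) (fun h' => ihn _ (by omega) h')
  | succ a iha =>
    intro n
    induction n with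
    | zero =>
      intro b hn h
      refine aux_step hℓ hrc h (fun _ => iha _ b le_rfl (aux_locked_up 1 (by omega) h))
        (fun h' => ?_)
      have := (aux_locked_mem (aux_locked_up (a := 1) (a + 1)
          (by omega) (by rwa [show 1 + (a + 1) = a + 1 + 1 by ring]))).2.2
      simp at this; omega
    | succ n ihn =>
      intro b hn h
      exact aux_step hℓ hrc h (fun _ => iha _ b le_rfl (aux_locked_up 1 (by omega) h))
        (fun h' => ihn _ (by omega) h')

end Helpers

/-- if `λ` and `μ` are in the same regularization class, then there is an
arrangement of `μ` from `λ` under which no locked box of `λ` moves down. -/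
theorem statement6 (ℓ : ℕ) (hℓ : 2 < ℓ) (lam mu : YPartition)
    (hrc : SameRegClass ℓ lam mu) :
    ∃ f : ℕ × ℕ → ℕ × ℕ,
      Set.BijOn f lam.cells mu.cells ∧
      (∀ p ∈ lam.cells, SameLadder ℓ p (f p)) ∧
      (∀ p ∈ lam.cells, Locked ℓ lam p → (f p).1 ≤ p.1) := by
  classical
  set m := ℓ - 1 with hm
  have hmpos : 0 < m := by omega
  have hT : ∀ k, Nat.count (RowOn ℓ lam k) (k + 1) = Nat.count (RowOn ℓ mu k) (k + 1) := by
    intro k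
    have := hrc k
    rw [aux_ladderCount ℓ hℓ, aux_ladderCount ℓ hℓ] at this
    convert this
  -- the column of the position of row `r` on ladder `k`
  have hcol : ∀ (P : YPartition) (p : ℕ × ℕ), p ∈ P.cells →
      p.2 = (ladderIdx ℓ p - p.1) / m + 1 := by
    rintro P ⟨r, d⟩ hp
    have hd := hp.2.1
    simp only [ladderIdx] at hd ⊢
    rw [← hm, Nat.add_sub_cancel_left, Nat.mul_div_cancel_left _ hmpos]
    omega
  have hlt : ∀ (P : YPartition) (p : ℕ × ℕ), p ∈ P.cells →
      Nat.count (RowOn ℓ P (ladderIdx ℓ p)) p.1 <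
        Nat.count (RowOn ℓ P (ladderIdx ℓ p)) (ladderIdx ℓ p + 1) := by
    intro P p hp
    have h : RowOn ℓ P (ladderIdx ℓ p) p.1 := ⟨p.2, hp, rfl⟩
    exact Nat.count_strict_mono h (aux_lt_of_rowOn h)
  have hpos : ∀ (P : YPartition) (k r : ℕ), RowOn ℓ P k r →
      (r, (k - r) / m + 1) ∈ P.cells ∧ ladderIdx ℓ (r, (k - r) / m + 1) = k := by
    rintro P k r ⟨d, hd, rfl⟩
    have := hcol P _ hd
    simp only at this
    rw [← this]
    exact ⟨hd, rfl⟩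
  have hrow : ∀ (P Q : YPartition), (∀ k, Nat.count (RowOn ℓ P k) (k + 1) =
      Nat.count (RowOn ℓ Q k) (k + 1)) → ∀ p ∈ P.cells,
      RowOn ℓ Q (ladderIdx ℓ p)
        (Nat.nth (RowOn ℓ Q (ladderIdx ℓ p)) (Nat.count (RowOn ℓ P (ladderIdx ℓ p)) p.1)) ∧
      Nat.count (RowOn ℓ Q (ladderIdx ℓ p))
        (Nat.nth (RowOn ℓ Q (ladderIdx ℓ p)) (Nat.count (RowOn ℓ P (ladderIdx ℓ p)) p.1)) =
      Nat.count (RowOn ℓ P (ladderIdx ℓ p)) p.1 := by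
    intro P Q h p hp
    have h1 := hlt P p hp
    rw [h] at h1
    have h2 := aux_nth (p := RowOn ℓ Q (ladderIdx ℓ p)) (n := Nat.count (RowOn ℓ P (ladderIdx ℓ p)) p.1) (N := ladderIdx ℓ p + 1) (by convert h1)
    refine ⟨h2.1, ?_⟩
    convert h2.2
  let F : YPartition → YPartition → ℕ × ℕ → ℕ × ℕ := fun P Q p =>
    (Nat.nth (RowOn ℓ Q (ladderIdx ℓ p)) (Nat.count (RowOn ℓ P (ladderIdx ℓ p)) p.1),
      (ladderIdx ℓ p - Nat.nth (RowOn ℓ Q (ladderIdx ℓ p))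
        (Nat.count (RowOn ℓ P (ladderIdx ℓ p)) p.1)) / m + 1)
  have hF : ∀ (P Q : YPartition), (∀ k, Nat.count (RowOn ℓ P k) (k + 1) =
      Nat.count (RowOn ℓ Q k) (k + 1)) → ∀ p ∈ P.cells,
      F P Q p ∈ Q.cells ∧ ladderIdx ℓ (F P Q p) = ladderIdx ℓ p := by
    intro P Q h p hp
    exact hpos Q _ _ (hrow P Q h p hp).1
  have hFF : ∀ (P Q : YPartition), (∀ k, Nat.count (RowOn ℓ P k) (k + 1) =
      Nat.count (RowOn ℓ Q k) (k + 1)) → ∀ p ∈ P.cells, F Q P (F P Q p) = p := by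
    intro P Q h p hp
    have h1 : (F Q P (F P Q p)).1 = p.1 := by
      change Nat.nth (RowOn ℓ P (ladderIdx ℓ (F P Q p)))
        (Nat.count (RowOn ℓ Q (ladderIdx ℓ (F P Q p))) (F P Q p).1) = p.1
      rw [(hF P Q h p hp).2]
      change Nat.nth (RowOn ℓ P (ladderIdx ℓ p)) (Nat.count (RowOn ℓ Q (ladderIdx ℓ p))
        (Nat.nth (RowOn ℓ Q (ladderIdx ℓ p)) (Nat.count (RowOn ℓ P (ladderIdx ℓ p)) p.1))) = p.1
      rw [(hrow P Q h p hp).2]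
      exact Nat.nth_count (p := RowOn ℓ P (ladderIdx ℓ p)) ⟨p.2, hp, rfl⟩
    have h2 := hF P Q h p hp
    have h3 := hF Q P (fun k => (h k).symm) _ h2.1
    refine Prod.ext h1 ?_
    rw [hcol P _ hp, hcol P _ h3.1, h1, h3.2, h2.2]
  have hT' := fun k => (hT k).symm
  refine ⟨F lam mu, ?_, ?_, ?_⟩
  · exact Set.InvOn.bijOn (f' := F mu lam)
      ⟨fun p hp => hFF lam mu hT p hp, fun p hp => hFF mu lam hT' p hp⟩
      (fun p hp => (hF lam mu hT p hp).1) (fun p hp => (hF mu lam hT' p hp).1)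
  · intro p hp
    obtain ⟨h1, h2⟩ := hF lam mu hT p hp
    have h3 := h1.2.1
    have h4 := hp.2.1
    generalize F lam mu p = q at *
    simp only [ladderIdx, SameLadder] at h2 ⊢
    zify [h3, h4, (show 1 ≤ ℓ by omega)] at h2
    linarith
  · rintro ⟨a, b⟩ hp hl
    obtain ⟨a, rfl⟩ : ∃ a', a = a' + 1 := ⟨a - 1, by have := hp.1; simp only at this; omega⟩
    have h := aux_main hℓ hrc a _ b le_rfl hl
    have h' : Nat.count (RowOn ℓ lam (ladderIdx ℓ (a + 1, b))) (a + 1) <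
        Nat.count (RowOn ℓ mu (ladderIdx ℓ (a + 1, b))) (a + 2) := by
      refine lt_of_lt_of_le ?_ (by convert h)
      exact Nat.count_strict_mono (p := RowOn ℓ lam (ladderIdx ℓ (a + 1, b)))
        ⟨b, hp, rfl⟩ (Nat.lt_succ_self _)
    have h'' := Nat.nth_lt_of_lt_count h'
    exact Nat.lt_succ_iff.mp h''
end
end

section
/- Fix an integer ℓ > 2 and a partition λ. Then Sλ is the unique smallest partition, with respect to dominance order, in the regularization class of λ; moreover Sλ is the unique partition in this regularization class all of whose boxes are locked. -/
noncomputable section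

open YPartition

namespace YPartition

/-! ### Zero-based coordinates -/

/-- Row lengths, zero based. -/
def rw0 (μ : YPartition) (i : ℕ) : ℕ := μ.part (i + 1)
/-- Column lengths, zero based. -/
def cl0 (μ : YPartition) (c : ℕ) : ℕ := μ.colLen (c + 1)
/-- Ladder of the first free position in column `c`. -/
def fH (m : ℕ) (μ : YPartition) (c : ℕ) : ℕ := μ.cl0 c + m * c
/-- Shifted ladder of the end of row `i`. -/
def eV (m : ℕ) (μ : YPartition) (i : ℕ) : ℕ := i + m * μ.rw0 i

lemma rw0_anti (μ : YPartition) {i j : ℕ} (h : i ≤ j) : μ.rw0 j ≤ μ.rw0 i :=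
  μ.antitone _ _ (by omega) (by omega)

lemma lt_cl0_iff (μ : YPartition) (i c : ℕ) : c < μ.rw0 i ↔ i < μ.cl0 c := by
  obtain ⟨N, hN⟩ := μ.eventually_zero
  -- the column is an initial segment
  have hex : ∃ n, μ.rw0 n ≤ c := ⟨N, by unfold rw0; rw [hN _ (by omega)]; omega⟩
  classical
  have h1 := Nat.find_spec hex
  have h2 : ∀ j, j < Nat.find hex → c < μ.rw0 j := fun j hj => by
    have := Nat.find_min hex hj; omega
  have hset : {a : ℕ | 1 ≤ a ∧ c + 1 ≤ μ.part a} = ↑(Finset.Icc 1 (Nat.find hex)) := by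
    ext a
    simp only [Set.mem_ofPred_eq, Finset.coe_Icc, Set.mem_Icc]
    constructor
    · rintro ⟨ha, hc⟩
      refine ⟨ha, ?_⟩
      by_contra hlt
      have := μ.rw0_anti (i := Nat.find hex) (j := a - 1) (by omega)
      unfold rw0 at this h1
      rw [Nat.sub_add_cancel ha] at this
      omega
    · rintro ⟨ha, hc⟩
      have := h2 (a - 1) (by omega)
      unfold rw0 at this
      rw [Nat.sub_add_cancel ha] at this
      exact ⟨ha, this⟩
  have hcl : μ.cl0 c = Nat.find hex := by
    unfold cl0 colLen
    rw [hset]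
    simp
  rw [hcl]
  constructor
  · intro h
    by_contra hlt
    have := μ.rw0_anti (i := Nat.find hex) (j := i) (by omega)
    omega
  · exact h2 i

lemma cl0_anti (μ : YPartition) {c d : ℕ} (h : c ≤ d) : μ.cl0 d ≤ μ.cl0 c := by
  by_contra hlt
  have h1 := (μ.lt_cl0_iff (μ.cl0 c) d).2 (by omega)
  have h2 := (μ.lt_cl0_iff (μ.cl0 c) c).1 (by omega)
  omega

lemma rw0_le_iff (μ : YPartition) (i c : ℕ) : μ.rw0 i ≤ c ↔ μ.cl0 c ≤ i := by
  have := μ.lt_cl0_iff i c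
  omega

lemma ext_rw0 {μ ν : YPartition} (h : ∀ i, μ.rw0 i = ν.rw0 i) : μ = ν := by
  have hp : μ.part = ν.part := by
    funext n
    cases n with
    | zero => rw [μ.zero_at_zero, ν.zero_at_zero]
    | succ n => exact h n
  cases μ; cases ν; simp at hp; subst hp; rfl

lemma ext_cl0 {μ ν : YPartition} (h : ∀ i, μ.cl0 i = ν.cl0 i) : μ = ν := by
  apply ext_rw0
  intro i
  have h1 := fun c => μ.lt_cl0_iff i c
  have h2 := fun c => ν.lt_cl0_iff i c
  rcases lt_trichotomy (μ.rw0 i) (ν.rw0 i) with hh | hh | hh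
  · have := h1 (μ.rw0 i); have := h2 (μ.rw0 i); have := h (μ.rw0 i); omega
  · exact hh
  · have := h1 (ν.rw0 i); have := h2 (ν.rw0 i); have := h (ν.rw0 i); omega

lemma mem_cells0 (μ : YPartition) (i c : ℕ) : (i + 1, c + 1) ∈ μ.cells ↔ c < μ.rw0 i := by
  unfold cells rw0
  simp only [Set.mem_ofPred_eq]
  omega

lemma fH_succ_le (m : ℕ) (μ : YPartition) (c : ℕ) : fH m μ (c + 1) ≤ fH m μ c + m := by
  unfold fH
  have := μ.cl0_anti (Nat.le_succ c)
  simp only [Nat.succ_eq_add_one] at this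
  rw [mul_add]; omega

lemma le_fH {m : ℕ} (hm : 1 ≤ m) (μ : YPartition) (c : ℕ) : c ≤ fH m μ c := by
  unfold fH; nlinarith

lemma eV_succ_le (m : ℕ) (μ : YPartition) (c : ℕ) : eV m μ (c + 1) ≤ eV m μ c + 1 := by
  unfold eV
  have := Nat.mul_le_mul_left m (μ.rw0_anti (Nat.le_succ c))
  simp only [Nat.succ_eq_add_one] at this
  omega

/-! ### Counting functions -/

/-- Number of columns `c ≥ b` with `fH c < K`. -/
def LL (m : ℕ) (μ : YPartition) (K b : ℕ) : ℕ :=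
  ((Finset.Ico b K).filter (fun c => fH m μ c < K)).card

/-- Number of columns `c ≥ b` with `fH c = k`. -/
def uu (m : ℕ) (μ : YPartition) (k b : ℕ) : ℕ :=
  ((Finset.Ico b (k + 1)).filter (fun c => fH m μ c = k)).card

/-- Number of columns `c < b` with `fH c = k`. -/
def lo (m : ℕ) (μ : YPartition) (k b : ℕ) : ℕ :=
  ((Finset.range b).filter (fun c => fH m μ c = k)).card

/-- Number of rows of length `> b` whose end is on ladder `k`. -/
def vv (m : ℕ) (μ : YPartition) (k b : ℕ) : ℕ :=
  ((Finset.range (μ.cl0 b)).filter (fun i => eV m μ i = k + m)).card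

lemma LL_zero (m : ℕ) (μ : YPartition) (b : ℕ) : LL m μ 0 b = 0 := by simp [LL]

lemma LL_succ {m : ℕ} (hm : 1 ≤ m) (μ : YPartition) (k b : ℕ) :
    LL m μ (k + 1) b = LL m μ k b + uu m μ k b := by
  unfold LL uu
  rw [← Finset.card_union_of_disjoint]
  · congr 1
    ext c
    have := le_fH hm μ c
    simp only [Finset.mem_filter, Finset.mem_Ico, Finset.mem_union]
    omega
  · rw [Finset.disjoint_left]
    intro c
    simp only [Finset.mem_filter]
    omega

lemma LL_rec {m : ℕ} (hm : 1 ≤ m) (μ : YPartition) (K b : ℕ) :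
    LL m μ K b = LL m μ K (b + 1) + if fH m μ b < K then 1 else 0 := by
  unfold LL
  have := le_fH hm μ b
  split_ifs with h
  · have hs : (Finset.Ico b K).filter (fun c => fH m μ c < K) =
        insert b ((Finset.Ico (b + 1) K).filter (fun c => fH m μ c < K)) := by
      ext c
      simp only [Finset.mem_filter, Finset.mem_Ico, Finset.mem_insert]
      constructor
      · intro hc
        by_cases hcb : c = b
        · exact Or.inl hcb
        · right; omega
      · rintro (rfl | hc)
        · omega
        · omega
    rw [hs, Finset.card_insert_of_notMem (by simp)]
  · rw [add_zero]
    congr 1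
    ext c
    simp only [Finset.mem_filter, Finset.mem_Ico]
    constructor
    · intro hc
      have : c ≠ b := by rintro rfl; omega
      omega
    · omega

lemma uu_lo {m : ℕ} (hm : 1 ≤ m) (μ : YPartition) (k b : ℕ) :
    uu m μ k 0 = lo m μ k b + uu m μ k b := by
  unfold uu lo
  rw [← Finset.card_union_of_disjoint]
  · congr 1
    ext c
    have := le_fH hm μ c
    simp only [Finset.mem_filter, Finset.mem_Ico, Finset.mem_union, Finset.mem_range]
    omega
  · rw [Finset.disjoint_left]
    intro c
    simp only [Finset.mem_filter, Finset.mem_Ico, Finset.mem_range]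
    omega

lemma vv_rec {m : ℕ} (hm : 1 ≤ m) (μ : YPartition) (k b : ℕ) :
    vv m μ k b = vv m μ k (b + 1) +
      if fH m μ (b + 1) ≤ k + m ∧ k < fH m μ b then 1 else 0 := by
  have hanti := μ.cl0_anti (Nat.le_succ b)
  simp only [Nat.succ_eq_add_one] at hanti
  have key : ∀ i, i < μ.cl0 b → μ.cl0 (b + 1) ≤ i → eV m μ i = i + m * b + m := by
    intro i h1 h2
    rw [← lt_cl0_iff] at h1
    rw [← rw0_le_iff] at h2
    have : μ.rw0 i = b + 1 := by omega
    unfold eV; rw [this]; ring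
  unfold vv
  split_ifs with h
  · unfold fH at h
    rw [mul_add] at h
    have hs : (Finset.range (μ.cl0 b)).filter (fun i => eV m μ i = k + m) =
        insert (k - m * b)
          ((Finset.range (μ.cl0 (b + 1))).filter (fun i => eV m μ i = k + m)) := by
      ext i
      simp only [Finset.mem_filter, Finset.mem_range, Finset.mem_insert]
      by_cases h1 : i < μ.cl0 b
      · by_cases h2 : μ.cl0 (b + 1) ≤ i
        · have := key i h1 h2
          omega
        · omega
      · omega
    rw [hs, Finset.card_insert_of_notMem]
    simp only [Finset.mem_filter, Finset.mem_range]
    omega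
  · rw [add_zero]
    congr 1
    ext i
    simp only [Finset.mem_filter, Finset.mem_range]
    unfold fH at h
    rw [mul_add] at h
    by_cases h1 : i < μ.cl0 b
    · by_cases h2 : μ.cl0 (b + 1) ≤ i
      · have := key i h1 h2
        omega
      · omega
    · omega

/-- The cut identity. -/
lemma cut_identity {m : ℕ} (hm : 1 ≤ m) (μ : YPartition) (k b : ℕ) :
    LL m μ (k + 1 + m) b = LL m μ (k + 1) b + vv m μ k b +
      if fH m μ b ≤ k + m then 1 else 0 := by
  -- downward induction on the cut
  have main : ∀ n b, k + 1 + m + μ.rw0 0 ≤ b + n →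
      LL m μ (k + 1 + m) b = LL m μ (k + 1) b + vv m μ k b +
      if fH m μ b ≤ k + m then 1 else 0 := by
    intro n
    induction n with
    | zero =>
      intro b hb
      have h1 : LL m μ (k + 1 + m) b = 0 := by
        unfold LL; rw [Finset.Ico_eq_empty (by omega)]; rfl
      have h2 : LL m μ (k + 1) b = 0 := by
        unfold LL; rw [Finset.Ico_eq_empty (by omega)]; rfl
      have h3 : μ.cl0 b = 0 := by
        have := (μ.rw0_le_iff 0 b).1 (by omega)
        omega
      have h4 : vv m μ k b = 0 := by unfold vv; rw [h3]; rfl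
      have h5 := le_fH hm μ b
      rw [h1, h2, h4, if_neg (by omega)]
    | succ n ih =>
      intro b hb
      have h1 := ih (b + 1) (by omega)
      have h2 := LL_rec hm μ (k + 1 + m) b
      have h3 := LL_rec hm μ (k + 1) b
      have h4 := vv_rec hm μ k b
      have h5 := fH_succ_le m μ b
      split_ifs at * <;> omega
  exact main (k + 1 + m + μ.rw0 0) b (by omega)

end YPartition

namespace YPartition

/-- Discrete intermediate values for functions increasing by at most one. -/
lemma disc_ivt (g : ℕ → ℕ) (hg : ∀ i, g (i + 1) ≤ g i + 1) (a b t : ℕ) (hab : a ≤ b)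
    (ha : g a ≤ t) (hb : t ≤ g b) : ∃ x, a ≤ x ∧ x ≤ b ∧ g x = t := by
  induction b, hab using Nat.le_induction with
  | base => exact ⟨a, le_rfl, le_rfl, by omega⟩
  | succ n hn ih =>
    by_cases h : t ≤ g n
    · obtain ⟨x, h1, h2, h3⟩ := ih h
      exact ⟨x, h1, by omega, h3⟩
    · have := hg n
      exact ⟨n + 1, by omega, le_rfl, by omega⟩

/-- Equality of the ladder statistics of two partitions. -/
def SameCl (m : ℕ) (μ ν : YPartition) : Prop := ∀ K, LL m μ K 0 = LL m ν K 0

/-- No column start lies below a row end on the same ladder. -/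
def Greedy (m : ℕ) (ν : YPartition) : Prop :=
  ∀ i c, c < ν.rw0 i → fH m ν c + m ≠ eV m ν i

/-- `ρ` lies below `μ` ladder by ladder. -/
def Below (m : ℕ) (ρ μ : YPartition) : Prop := ∀ K b, LL m μ K b ≤ LL m ρ K b

lemma SameCl.uu_eq {m : ℕ} (hm : 1 ≤ m) {μ ν : YPartition} (h : SameCl m μ ν) (k : ℕ) :
    uu m μ k 0 = uu m ν k 0 := by
  have h1 := LL_succ hm μ k 0
  have h2 := LL_succ hm ν k 0
  have h3 := h k
  have h4 := h (k + 1)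
  omega

lemma visit_up {m : ℕ} (hm : 1 ≤ m) (ρ : YPartition) (b i c : ℕ) (hc : b ≤ c)
    (h1 : fH m ρ c ≤ i) (h2 : i + m < fH m ρ b) : 1 ≤ vv m ρ i b := by
  have hcl := ρ.cl0_anti hc
  have hmul := Nat.mul_le_mul_left m hc
  have hlt : ρ.cl0 c < ρ.cl0 b := by
    unfold fH at h1 h2; omega
  obtain ⟨x, hx1, hx2, hx3⟩ := disc_ivt (eV m ρ) (eV_succ_le m ρ) (ρ.cl0 c) (ρ.cl0 b - 1) (i + m)
    (by omega)
    (by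
      have h3 := (ρ.rw0_le_iff (ρ.cl0 c) c).2 le_rfl
      have := Nat.mul_le_mul_left m h3
      unfold eV; unfold fH at h1; omega)
    (by
      have h3 := (ρ.lt_cl0_iff (ρ.cl0 b - 1) b).2 (by omega)
      have := Nat.mul_le_mul_left m h3
      unfold eV; unfold fH at h2
      simp only [Nat.succ_eq_add_one, mul_add] at this
      omega)
  unfold vv
  rw [Nat.one_le_iff_ne_zero, Finset.card_ne_zero]
  exact ⟨x, by simp only [Finset.mem_filter, Finset.mem_range]; omega⟩

/-- A greedy partition lies ladderwise below every partition in its class. -/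
theorem greedy_below {m : ℕ} (hm : 1 ≤ m) {ν ρ : YPartition} (hν : Greedy m ν)
    (hcl : SameCl m ν ρ) : Below m ν ρ := by
  intro K0 b
  by_contra hviol
  push Not at hviol
  set G : ℕ → ℤ := fun K => (LL m ρ K b : ℤ) - LL m ν K b with hG
  have hG0 : G 0 = 0 := by simp [hG, LL_zero]
  -- eventually zero
  obtain ⟨B, hB⟩ : ∃ B, ∀ K, B ≤ K → G K = 0 := by
    have aux : ∀ (μ : YPartition) b, ∃ B, ∀ K, B ≤ K → LL m μ K 0 = LL m μ K b + b := by
      intro μ b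
      induction b with
      | zero => exact ⟨0, fun _ _ => rfl⟩
      | succ b ih =>
        obtain ⟨B, hB⟩ := ih
        refine ⟨B + fH m μ b + 1, fun K hK => ?_⟩
        have h1 := hB K (by omega)
        have h2 := LL_rec hm μ K b
        rw [if_pos (by omega)] at h2
        omega
    obtain ⟨B1, h1⟩ := aux ν b
    obtain ⟨B2, h2⟩ := aux ρ b
    refine ⟨B1 + B2, fun K hK => ?_⟩
    have := h1 K (by omega)
    have := h2 K (by omega)
    have := hcl K
    simp only [hG]
    omega
  have hpos : 0 < G K0 := by simp only [hG]; omega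
  -- the maximum and the last place where it is attained
  obtain ⟨K1, hK1⟩ : ∃ K1, ∀ K, G K ≤ G K1 := by
    obtain ⟨K1, -, h⟩ := Finset.exists_max_image (Finset.range (B + 1)) G ⟨0, by simp⟩
    refine ⟨K1, fun K => ?_⟩
    by_cases hK : K ≤ B
    · exact h K (by simp; omega)
    · rw [hB K (by omega), ← hG0]
      exact h 0 (by simp)
  set g := G K1 with hg
  have hgpos : 0 < g := lt_of_lt_of_le hpos (hK1 K0)
  obtain ⟨K', hK', hlast⟩ : ∃ K', G K' = g ∧ ∀ K, K' < K → G K < g := by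
    have hK1B : K1 ≤ B := by
      by_contra h
      have := hB K1 (by omega)
      omega
    refine ⟨Nat.findGreatest (fun K => G K = g) B, ?_, ?_⟩
    · exact Nat.findGreatest_spec (P := fun K => G K = g) hK1B rfl
    · intro K hK
      by_cases hKB : K ≤ B
      · have := Nat.findGreatest_is_greatest hK hKB
        exact lt_of_le_of_ne (hK1 K) this
      · rw [hB K (by omega)]; exact hgpos
  -- the bottom of the final run
  have hex : ∃ k, k ≤ K' ∧ ∀ j, k ≤ j → j ≤ K' → G j = g :=
    ⟨K', le_rfl, fun j h1 h2 => by rw [le_antisymm h2 h1, hK']⟩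
  classical
  obtain ⟨hKle, hrun⟩ := Nat.find_spec hex
  have hmin := fun j (hj : j < Nat.find hex) => Nat.find_min hex hj
  obtain ⟨k, hk⟩ : ∃ k, Nat.find hex = k + 1 := by
    cases hh : Nat.find hex with
    | zero =>
      have := hrun 0 (by omega) (by omega)
      omega
    | succ k => exact ⟨k, rfl⟩
  rw [hk] at hKle hrun hmin
  clear hk
  have hGk : G k < g := by
    refine lt_of_le_of_ne (hK1 k) (fun h => hmin k (by omega) ⟨by omega, fun j h1 h2 => ?_⟩)
    rcases Nat.eq_or_lt_of_le h1 with rfl | h3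
    · exact h
    · exact hrun j h3 h2
  have hGk1 : G (k + 1) = g := hrun _ le_rfl hKle
  have hu : uu m ν k b < uu m ρ k b := by
    have h1 := LL_succ hm ν k b
    have h2 := LL_succ hm ρ k b
    simp only [hG] at hGk hGk1
    omega
  -- `ρ` has a column `≥ b` at height `k`
  obtain ⟨c1, hc1b, hc1⟩ : ∃ c, b ≤ c ∧ fH m ρ c = k := by
    have : uu m ρ k b ≠ 0 := by omega
    unfold uu at this
    rw [Finset.card_ne_zero] at this
    obtain ⟨c, hc⟩ := this
    simp only [Finset.mem_filter, Finset.mem_Ico] at hc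
    exact ⟨c, by omega, hc.2⟩
  -- `ν` has a column `< b` at height `k`
  obtain ⟨c0, hc0b, hc0⟩ : ∃ c, c < b ∧ fH m ν c = k := by
    have h1 := uu_lo hm ν k b
    have h2 := uu_lo hm ρ k b
    have h3 := hcl.uu_eq hm k
    have : lo m ν k b ≠ 0 := by omega
    unfold lo at this
    rw [Finset.card_ne_zero] at this
    obtain ⟨c, hc⟩ := this
    simp only [Finset.mem_filter, Finset.mem_range] at hc
    exact ⟨c, hc⟩
  have hvν : vv m ν k b = 0 := by
    unfold vv
    rw [Finset.card_eq_zero, Finset.filter_eq_empty_iff]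
    intro i hi he
    rw [Finset.mem_range, ← lt_cl0_iff] at hi
    exact hν i c0 (by omega) (by omega)
  have hcut : ∀ i, G (i + 1) - G (i + 1 + m) = (vv m ν i b : ℤ) - vv m ρ i b
      + (if fH m ν b ≤ i + m then 1 else 0) - (if fH m ρ b ≤ i + m then 1 else 0) := by
    intro i
    have h1 := cut_identity hm ν i b
    have h2 := cut_identity hm ρ i b
    simp only [hG]
    split_ifs at * <;> omega
  have hup : ∀ i, k ≤ i → i + m < fH m ρ b → 1 ≤ vv m ρ i b := fun i hi h =>
    visit_up hm ρ b i c1 hc1b (by omega) h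
  have hc := hcut k
  have hle := hK1 (k + 1 + m)
  have hupk := hup k le_rfl
  have hGkm : G (k + 1 + m) = g := by
    split_ifs at hc <;> omega
  have hposν : fH m ν b ≤ k + m := by
    by_contra hcon
    rw [if_neg hcon] at hc
    split_ifs at hc <;> omega
  have hKm : k + 1 + m ≤ K' := by
    by_contra hcon
    have := hlast (k + 1 + m) (by omega)
    omega
  have hvW : ∀ i, K' ≤ i + m → i < K' → 1 ≤ vv m ν i b := by
    intro i h1 h2
    have h3 := hcut i
    have h4 := hrun (i + 1) (by omega) (by omega)
    have h5 := hlast (i + 1 + m) (by omega)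
    have h6 := hup i (by omega)
    rw [if_pos (by omega : fH m ν b ≤ i + m)] at h3
    split_ifs at h3 <;> omega
  -- the last column of `ν` above the window
  have hexc : ∃ c, b ≤ c ∧ K' - m ≤ fH m ν c :=
    ⟨b + K', by omega, by have := le_fH hm ν (b + K'); omega⟩
  obtain ⟨hcb, hcK⟩ := Nat.find_spec hexc
  have hcmin := fun j (hj : j < Nat.find hexc) => Nat.find_min hexc hj
  set c := Nat.find hexc with hcdef
  have hfc : fH m ν c < K' := by
    rcases Nat.eq_or_lt_of_le hcb with h | h
    · rw [← h]; omega
    · have h1 := hcmin (c - 1) (by omega)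
      have h2 := fH_succ_le m ν (c - 1)
      rw [Nat.sub_add_cancel (by omega)] at h2
      have : ¬ (K' - m ≤ fH m ν (c - 1)) := fun h3 => h1 ⟨by omega, h3⟩
      omega
  have hv := hvW (fH m ν c) (by omega) hfc
  have hv' : vv m ν (fH m ν c) b ≠ 0 := by omega
  unfold vv at hv'
  rw [Finset.card_ne_zero] at hv'
  obtain ⟨a, ha⟩ := hv'
  simp only [Finset.mem_filter, Finset.mem_range] at ha
  obtain ⟨ha1, ha2⟩ := ha
  rw [← lt_cl0_iff] at ha1
  have hra : ν.rw0 a ≤ c := by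
    by_contra hcon
    exact hν a c (by omega) ha2.symm
  refine hcmin (ν.rw0 a - 1) (by omega) ⟨by omega, ?_⟩
  have h7 := (ν.lt_cl0_iff a (ν.rw0 a - 1)).1 (by omega)
  have h8 : m * ν.rw0 a = m * (ν.rw0 a - 1) + m := by
    obtain ⟨t, ht⟩ : ∃ t, ν.rw0 a = t + 1 := ⟨ν.rw0 a - 1, by omega⟩
    rw [ht, Nat.add_sub_cancel]; ring
  unfold eV at ha2
  have h9 : fH m ν (ν.rw0 a - 1) = ν.cl0 (ν.rw0 a - 1) + m * (ν.rw0 a - 1) := rfl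
  omega

lemma Below.eq {m : ℕ} (hm : 1 ≤ m) {μ ν : YPartition} (h1 : Below m μ ν) (h2 : Below m ν μ) :
    μ = ν := by
  apply ext_cl0
  intro c
  have key : ∀ K, fH m μ c < K ↔ fH m ν c < K := by
    intro K
    have e1 := LL_rec hm μ K c
    have e2 := LL_rec hm ν K c
    have := h1 K c; have := h2 K c; have := h1 K (c + 1); have := h2 K (c + 1)
    split_ifs at * <;> omega
  have k1 := key (fH m μ c + 1)
  have k2 := key (fH m ν c + 1)
  have : fH m μ c = fH m ν c := by omega
  unfold fH at this
  omega

/-- Clear subdiagrams survive when going down ladderwise. -/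
theorem clear_survives {m : ℕ} (hm : 1 ≤ m) {lam ρ : YPartition} (hcl : SameCl m lam ρ)
    (hb : Below m ρ lam) (z : ℕ → ℕ) (hz : ∀ i, z (i + 1) ≤ z i)
    (hclear : ∀ i c, c < z i → fH m lam c + m ≠ i + m * z i) : ∀ a, z a ≤ ρ.rw0 a := by
  have hzanti : Antitone z := antitone_nat_of_succ_le hz
  intro a
  induction a using Nat.strong_induction_on with
  | _ a ih =>
  by_contra hviol
  push Not at hviol
  obtain ⟨b, hbz⟩ : ∃ b, z a = b + 1 := ⟨z a - 1, by omega⟩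
  have hca : ρ.cl0 b = a := by
    have h1 := (ρ.rw0_le_iff a b).1 (by omega)
    rcases Nat.eq_zero_or_pos a with h | h
    · omega
    · have h2 := ih (a - 1) (by omega)
      have h3 := hz (a - 1)
      rw [Nat.sub_add_cancel h] at h3
      have h4 := (ρ.lt_cl0_iff (a - 1) b).1 (by omega)
      omega
  set k := a + m * b with hk
  have hfb : fH m ρ b = k := by unfold fH; rw [hca]
  have hloz : ∀ j, (∀ c, c < b + 1 → fH m lam c ≠ j) → uu m ρ j (b + 1) + lo m ρ j (b + 1)
      = uu m lam j (b + 1) := by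
    intro j hj
    have h1 := uu_lo hm lam j (b + 1)
    have h2 := uu_lo hm ρ j (b + 1)
    have h3 := hcl.uu_eq hm j
    have h4 : lo m lam j (b + 1) = 0 := by
      unfold lo
      rw [Finset.card_eq_zero, Finset.filter_eq_empty_iff]
      intro c hc
      exact hj c (Finset.mem_range.1 hc)
    omega
  have hlt : LL m lam k (b + 1) < LL m ρ k (b + 1) := by
    have h1 := hloz k (fun c hc h => hclear a c (by omega) (by rw [h, hbz, hk]; ring))
    have h2 : 1 ≤ lo m ρ k (b + 1) := by
      unfold lo
      rw [Nat.one_le_iff_ne_zero, Finset.card_ne_zero]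
      exact ⟨b, by simp [hfb]⟩
    have h3 := LL_succ hm lam k (b + 1)
    have h4 := LL_succ hm ρ k (b + 1)
    have h5 := hb (k + 1) (b + 1)
    omega
  have hle : ∀ j, j < k → uu m ρ j (b + 1) ≤ uu m lam j (b + 1) := by
    intro j hj
    by_cases h0 : uu m ρ j (b + 1) = 0
    · omega
    unfold uu at h0
    rw [← ne_eq, Finset.card_ne_zero] at h0
    obtain ⟨c, hc⟩ := h0
    simp only [Finset.mem_filter, Finset.mem_Ico] at hc
    obtain ⟨⟨hcb, -⟩, hfc⟩ := hc
    have hx := ρ.cl0_anti (show b ≤ c by omega)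
    have hmc := Nat.mul_le_mul_left m hcb
    rw [mul_add] at hmc
    unfold fH at hfc
    have hxa : ρ.cl0 c < a := by omega
    have hzx : z (ρ.cl0 c) ≤ c := (ih _ hxa).trans ((ρ.rw0_le_iff _ c).2 le_rfl)
    obtain ⟨x, hx1, hx2, hx3⟩ := disc_ivt (fun i => i + m * z i)
      (fun i => by have := Nat.mul_le_mul_left m (hz i); omega)
      (ρ.cl0 c) a (j + m) (by omega)
      (by have := Nat.mul_le_mul_left m hzx; omega)
      (by rw [hbz, mul_add]; omega)
    have hzz := hzanti hx2
    have := hloz j (fun c hc h => hclear x c (by omega) (by rw [h, hx3]))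
    omega
  have : ∀ K, K ≤ k → LL m ρ K (b + 1) ≤ LL m lam K (b + 1) := by
    intro K
    induction K with
    | zero => simp [LL_zero]
    | succ K ihK =>
      intro hK
      have h1 := LL_succ hm lam K (b + 1)
      have h2 := LL_succ hm ρ K (b + 1)
      have h3 := hle K (by omega)
      have := ihK (by omega)
      omega
  have := this k le_rfl
  omega

end YPartition

namespace YPartition

/-! ### Existence of a greedy partition in each class -/

lemma LL_rows {m : ℕ} (hm : 1 ≤ m) (μ : YPartition) (k : ℕ) :
    LL m μ (k + 1) 0 =
      ((Finset.range (k + 1)).filter (fun i => eV m μ i ≤ k ∧ i % m = k % m)).card := by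
  unfold LL
  refine Finset.card_bij' (fun c _ => k - m * c) (fun i _ => (k - i) / m) ?_ ?_ ?_ ?_
  · intro c hc
    simp only [Finset.mem_filter, Finset.mem_Ico, Finset.mem_range] at hc ⊢
    unfold fH at hc
    refine ⟨by omega, ?_, ?_⟩
    · have h1 := (μ.rw0_le_iff (k - m * c) c).2 (by omega)
      have := Nat.mul_le_mul_left m h1
      unfold eV; omega
    · obtain ⟨t, ht⟩ : ∃ t, k = t + m * c := ⟨k - m * c, by omega⟩
      rw [ht, Nat.add_sub_cancel, Nat.add_mul_mod_self_left]
  · intro i hi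
    simp only [Finset.mem_filter, Finset.mem_Ico, Finset.mem_range] at hi ⊢
    obtain ⟨h1, h2, h3⟩ := hi
    unfold eV at h2
    obtain ⟨t, ht⟩ : m ∣ k - i := (Nat.modEq_iff_dvd' (by omega)).1 h3
    rw [ht, Nat.mul_div_cancel_left _ hm]
    have ht' : k = i + m * t := by omega
    have hrt : μ.rw0 i ≤ t := by
      by_contra hcon
      have := Nat.mul_lt_mul_of_pos_left (show t < μ.rw0 i by omega) hm
      omega
    have := (μ.rw0_le_iff i t).1 hrt
    unfold fH
    have : t ≤ m * t := Nat.le_mul_of_pos_left _ hm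
    omega
  · intro c hc
    simp only [Finset.mem_filter, Finset.mem_Ico] at hc
    unfold fH at hc
    rw [show k - (k - m * c) = m * c by omega, Nat.mul_div_cancel_left _ hm]
  · intro i hi
    simp only [Finset.mem_filter, Finset.mem_range] at hi
    obtain ⟨h1, h2, h3⟩ := hi
    obtain ⟨t, ht⟩ : m ∣ k - i := (Nat.modEq_iff_dvd' (by omega)).1 h3
    rw [ht, Nat.mul_div_cancel_left _ hm]
    omega

/-- Build a partition from zero based row lengths. -/
def ofRows (r : ℕ → ℕ) (hr : ∀ i, r (i + 1) ≤ r i) (hN : ∃ N, ∀ i, N ≤ i → r i = 0) :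
    YPartition where
  part n := if n = 0 then 0 else r (n - 1)
  zero_at_zero := by simp
  antitone i j hi hj := by
    rw [if_neg (by omega), if_neg (by omega)]
    exact antitone_nat_of_succ_le hr (by omega)
  eventually_zero := by
    obtain ⟨N, h⟩ := hN
    refine ⟨N + 1, fun i hi => ?_⟩
    rw [if_neg (by omega), h _ (by omega)]

lemma ofRows_rw0 (r : ℕ → ℕ) (hr : ∀ i, r (i + 1) ≤ r i) (hN : ∃ N, ∀ i, N ≤ i → r i = 0)
    (i : ℕ) : (ofRows r hr hN).rw0 i = r i := by
  simp [rw0, ofRows]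

/-- Exchanging two closed segments of the boundary path. -/
lemma exchange {m : ℕ} (hm : 1 ≤ m) (ρ : YPartition) (a d : ℕ) (hd : d < ρ.rw0 a)
    (h : fH m ρ d + m = eV m ρ a) :
    ∃ ρ' : YPartition, SameCl m ρ ρ' ∧ (∀ i, i < a → ρ'.rw0 i = ρ.rw0 i) ∧
      ρ'.rw0 a < ρ.rw0 a := by
  obtain ⟨D, hD⟩ : ∃ D, ρ.rw0 a = d + 1 + D := ⟨ρ.rw0 a - (d + 1), by omega⟩
  have hac := (ρ.lt_cl0_iff a d).1 hd
  set c := ρ.cl0 d with hcdef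
  have hc : c = a + m * D := by
    have h' := h
    unfold fH eV at h'
    rw [hD, ← hcdef] at h'
    have : m * (d + 1 + D) = m * d + m + m * D := by ring
    omega
  have hrc : ρ.rw0 c ≤ d := (ρ.rw0_le_iff c d).2 le_rfl
  have hrc1 : d < ρ.rw0 (c - 1) := (ρ.lt_cl0_iff _ _).2 (by omega)
  have hfd : fH m ρ d = c + m * d := rfl
  obtain ⟨c', hcc', -, hc'⟩ := disc_ivt (eV m ρ) (eV_succ_le m ρ) c (c + m * d + m) (c + m * d + m)
    (by omega) (by have := Nat.mul_le_mul_left m hrc; unfold eV; omega) (by unfold eV; omega)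
  have hlt : c < c' := by
    rcases Nat.eq_or_lt_of_le hcc' with h1 | h1
    · have := Nat.mul_le_mul_left m hrc
      rw [← h1] at hc'
      unfold eV at hc'
      omega
    · exact h1
  have hx : ρ.rw0 c' ≤ d := (ρ.rw0_anti hcc').trans hrc
  obtain ⟨D', hD'⟩ : ∃ D', d + 1 = ρ.rw0 c' + D' := ⟨d + 1 - ρ.rw0 c', by omega⟩
  have hcc2 : c' = c + m * D' := by
    unfold eV at hc'
    have : m * d + m = m * ρ.rw0 c' + m * D' := by rw [← mul_add, ← hD']; ring
    omega
  set q := m * D with hq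
  set p := m * D' with hp
  set r' : ℕ → ℕ := fun i => if i < a then ρ.rw0 i else if i < a + p then ρ.rw0 (i + q) + D
    else if i < a + p + q then ρ.rw0 (i - p) - D' else ρ.rw0 i with hr'
  have hranti : ∀ i, r' (i + 1) ≤ r' i := by
    intro i
    simp only [hr']
    by_cases h1 : i + 1 < a
    · rw [if_pos h1, if_pos (by omega)]; exact ρ.rw0_anti (by omega)
    by_cases h2 : i + 1 = a
    · rw [if_neg h1, if_pos (by omega : i + 1 < a + p), if_pos (by omega : i < a)]
      have := ρ.rw0_anti (show i ≤ a by omega)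
      rw [show i + 1 + q = c by omega]
      omega
    by_cases h3 : i + 1 < a + p
    · rw [if_neg h1, if_pos h3, if_neg (by omega), if_pos (by omega)]
      have := ρ.rw0_anti (show i + q ≤ i + 1 + q by omega)
      omega
    by_cases h4 : i + 1 = a + p
    · rw [if_neg h1, if_neg h3, if_pos (by omega), if_neg (by omega), if_pos (by omega)]
      rw [show i + 1 - p = a by omega]
      have := ρ.rw0_anti (show i + q ≤ c' by omega)
      omega
    by_cases h5 : i + 1 < a + p + q
    · rw [if_neg h1, if_neg h3, if_pos h5, if_neg (by omega), if_neg (by omega),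
        if_pos (by omega)]
      have := ρ.rw0_anti (show i - p ≤ i + 1 - p by omega)
      omega
    by_cases h6 : i + 1 = a + p + q
    · rw [if_neg h1, if_neg h3, if_neg h5, if_neg (by omega), if_neg (by omega),
        if_pos (by omega)]
      rw [show i - p = c - 1 by omega, show i + 1 = c' by omega]
      omega
    · rw [if_neg h1, if_neg h3, if_neg h5, if_neg (by omega), if_neg (by omega),
        if_neg (by omega)]
      exact ρ.rw0_anti (by omega)
  have hrzero : ∃ N, ∀ i, N ≤ i → r' i = 0 := by
    obtain ⟨N, hN⟩ := ρ.eventually_zero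
    refine ⟨N + a + p + q, fun i hi => ?_⟩
    simp only [hr']
    rw [if_neg (by omega), if_neg (by omega), if_neg (by omega)]
    exact hN _ (by omega)
  have hrw := ofRows_rw0 r' hranti hrzero
  set ρ' := ofRows r' hranti hrzero with hρ'
  have e1 : ∀ i, i < a → eV m ρ' i = eV m ρ i := by
    intro i hi; unfold eV; rw [hrw]; simp only [hr']; rw [if_pos hi]
  have e2 : ∀ i, a ≤ i → i < a + p → eV m ρ' i = eV m ρ (i + q) := by
    intro i hi hi2; unfold eV; rw [hrw]; simp only [hr']
    rw [if_neg (by omega), if_pos hi2, mul_add]; omega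
  have e3 : ∀ i, a + p ≤ i → i < a + p + q → eV m ρ' i = eV m ρ (i - p) := by
    intro i hi hi2; unfold eV; rw [hrw]; simp only [hr']
    rw [if_neg (by omega), if_neg (by omega), if_pos hi2]
    have h1 := ρ.rw0_anti (show i - p ≤ c - 1 by omega)
    obtain ⟨t, ht⟩ : ∃ t, ρ.rw0 (i - p) = t + D' := ⟨ρ.rw0 (i - p) - D', by omega⟩
    rw [ht, Nat.add_sub_cancel, mul_add]; omega
  have e4 : ∀ i, a + p + q ≤ i → eV m ρ' i = eV m ρ i := by
    intro i hi; unfold eV; rw [hrw]; simp only [hr']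
    rw [if_neg (by omega), if_neg (by omega), if_neg (by omega)]
  have modq : ∀ i, (i + q) % m = i % m := fun i => by rw [hq, Nat.add_mul_mod_self_left]
  have modp : ∀ i, (i + p) % m = i % m := fun i => by rw [hp, Nat.add_mul_mod_self_left]
  refine ⟨ρ', ?_, ?_, ?_⟩
  · intro K
    cases K with
    | zero => simp [LL_zero]
    | succ k =>
      rw [LL_rows hm, LL_rows hm]
      symm
      have hle : ∀ i, i ≤ eV m ρ i := fun i => by unfold eV; omega
      have hle' : ∀ i, i ≤ eV m ρ' i := fun i => by unfold eV; omega
      refine Finset.card_bij'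
        (fun i _ => if i < a then i else if i < a + p then i + q
          else if i < a + p + q then i - p else i)
        (fun i _ => if i < a then i else if i < a + q then i + p
          else if i < a + p + q then i - q else i) ?_ ?_ ?_ ?_
      · intro i hi
        simp only [Finset.mem_filter, Finset.mem_range] at hi ⊢
        obtain ⟨h1, h2, h3⟩ := hi
        split_ifs with g1 g2 g3
        · rw [← e1 i g1]; omega
        · have := hle (i + q)
          rw [e2 i (by omega) g2] at h2
          rw [modq]; omega
        · have := hle (i - p)
          rw [e3 i (by omega) g3] at h2
          have := modp (i - p)
          rw [Nat.sub_add_cancel (by omega)] at this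
          omega
        · rw [← e4 i (by omega)]; omega
      · intro i hi
        simp only [Finset.mem_filter, Finset.mem_range] at hi ⊢
        obtain ⟨h1, h2, h3⟩ := hi
        split_ifs with g1 g2 g3
        · rw [e1 i g1]; omega
        · have := hle' (i + p)
          have h4 := e3 (i + p) (by omega) (by omega)
          rw [Nat.add_sub_cancel] at h4
          rw [modp]; omega
        · have := hle' (i - q)
          have h4 := e2 (i - q) (by omega) (by omega)
          rw [Nat.sub_add_cancel (by omega)] at h4
          have := modq (i - q)
          rw [Nat.sub_add_cancel (by omega)] at this
          omega
        · rw [e4 i (by omega)]; omega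
      · intro i hi
        split_ifs <;> omega
      · intro i hi
        split_ifs <;> omega
  · intro i hi
    rw [hrw]; simp only [hr']; rw [if_pos hi]
  · rw [hrw]; simp only [hr']
    rw [if_neg (by omega), if_pos (by omega), ← hc]
    omega

lemma SameCl.symm {m : ℕ} {μ ν : YPartition} (h : SameCl m μ ν) : SameCl m ν μ :=
  fun K => (h K).symm

lemma SameCl.trans {m : ℕ} {μ ν ρ : YPartition} (h : SameCl m μ ν) (h' : SameCl m ν ρ) :
    SameCl m μ ρ := fun K => (h K).trans (h' K)

lemma class_bound {m : ℕ} (hm : 1 ≤ m) (lam : YPartition) :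
    ∃ M, ∀ ρ, SameCl m lam ρ → ρ.cl0 0 ≤ M := by
  refine ⟨lam.cl0 0 + m * lam.rw0 0, fun ρ hρ => ?_⟩
  set M := lam.cl0 0 + m * lam.rw0 0 with hM
  have hsub : ∀ μ : YPartition, (Finset.Ico 0 (M + 1)).filter (fun c => fH m μ c < M + 1) ⊆
      (Finset.Ico 0 (M + 1)).filter (fun c => m * c < M + 1) := by
    intro μ c
    simp only [Finset.mem_filter]
    unfold fH
    rintro ⟨h1, h2⟩
    exact ⟨h1, by omega⟩
  have hlam : (Finset.Ico 0 (M + 1)).filter (fun c => fH m lam c < M + 1) =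
      (Finset.Ico 0 (M + 1)).filter (fun c => m * c < M + 1) := by
    apply (hsub lam).antisymm
    intro c
    simp only [Finset.mem_filter]
    rintro ⟨h1, h2⟩
    refine ⟨h1, ?_⟩
    unfold fH
    by_cases hc : c < lam.rw0 0
    · have := Nat.mul_le_mul_left m hc.le
      have := lam.cl0_anti (Nat.zero_le c)
      omega
    · have := (lam.rw0_le_iff 0 c).1 (by omega)
      omega
  have heq := Finset.eq_of_subset_of_card_le (hsub ρ) (by
    rw [← hlam]; exact (hρ (M + 1)).le)
  have : (0 : ℕ) ∈ (Finset.Ico 0 (M + 1)).filter (fun c => fH m ρ c < M + 1) := by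
    rw [heq]; simp
  simp only [Finset.mem_filter] at this
  have h := this.2
  unfold fH at h
  omega

theorem exists_greedy {m : ℕ} (hm : 1 ≤ m) (lam : YPartition) :
    ∃ ν, SameCl m lam ν ∧ Greedy m ν := by
  obtain ⟨M, hM⟩ := class_bound hm lam
  let rel : YPartition → YPartition → Prop := fun μ ν =>
    Pi.Lex (· < ·) (fun {_} => (· < ·)) (fun i : Fin M => μ.rw0 i) (fun i : Fin M => ν.rw0 i)
  have hwf : WellFounded rel :=
    InvImage.wf (fun (μ : YPartition) (i : Fin M) => μ.rw0 i)
      (Pi.Lex.wellFounded (ι := Fin M) (α := fun _ => ℕ) (· < ·) (fun _ => wellFounded_lt))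
  obtain ⟨ν, hν, hmin⟩ := hwf.has_min {ν | SameCl m lam ν} ⟨lam, fun _ => rfl⟩
  refine ⟨ν, hν, ?_⟩
  intro a d hd hcon
  obtain ⟨ρ', h1, h2, h3⟩ := exchange hm ν a d hd hcon
  have haM : a < M := by
    have := (ν.lt_cl0_iff a 0).1 (by omega)
    have := hM ν hν
    omega
  refine hmin ρ' (SameCl.trans hν h1) ?_
  refine ⟨⟨a, haM⟩, fun j hj => ?_, h3⟩
  exact h2 j hj

end YPartition

namespace YPartition

/-! ### Columns of a ladder -/

/-- Columns meeting ladder `k` (zero based). -/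
def colsOf (m k : ℕ) : Finset ℕ := (Finset.range (k + 1)).filter (fun c => m * c ≤ k)

/-- The position of ladder `k` in column `c`. -/
def posn (m k c : ℕ) : ℕ × ℕ := (k - m * c + 1, c + 1)

lemma mem_colsOf {m : ℕ} (hm : 1 ≤ m) (k c : ℕ) : c ∈ colsOf m k ↔ m * c ≤ k := by
  unfold colsOf
  simp only [Finset.mem_filter, Finset.mem_range]
  have : c ≤ m * c := Nat.le_mul_of_pos_left _ hm
  omega

lemma posn_mem_cells {m : ℕ} (μ : YPartition) {k c : ℕ} (h : m * c ≤ k) :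
    posn m k c ∈ μ.cells ↔ k < fH m μ c := by
  unfold posn
  rw [mem_cells0, lt_cl0_iff]
  unfold fH
  omega

open Classical in
lemma ladder_ncard {ℓ m : ℕ} (hm : 1 ≤ m) (hℓ : ℓ = m + 1) (X : Set (ℕ × ℕ)) (k : ℕ) :
    (X ∩ LadderPositions ℓ (k + 1)).ncard =
      ((colsOf m k).filter (fun c => posn m k c ∈ X)).card := by
  have hset : X ∩ LadderPositions ℓ (k + 1) =
      ↑(((colsOf m k).filter (fun c => posn m k c ∈ X)).image (posn m k)) := by
    ext ⟨a, b⟩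
    simp only [Set.mem_inter_iff, LadderPositions, Set.mem_ofPred_eq, ladderIdx, Finset.coe_image,
      Set.mem_image, Finset.mem_coe, Finset.mem_filter, mem_colsOf hm]
    subst hℓ
    rw [Nat.add_sub_cancel]
    constructor
    · rintro ⟨h1, h2, h3, h4⟩
      have : posn m k (b - 1) = (a, b) := by
        unfold posn
        rw [Prod.mk.injEq]
        omega
      exact ⟨b - 1, ⟨by omega, by rw [this]; exact h1⟩, this⟩
    · rintro ⟨c, ⟨h1, h2⟩, h3⟩
      rw [h3] at h2
      unfold posn at h3
      rw [Prod.mk.injEq] at h3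
      obtain ⟨h3, h4⟩ := h3
      refine ⟨h2, by omega, by omega, ?_⟩
      rw [← h4, Nat.add_sub_cancel]
      omega
  rw [hset, Set.ncard_coe_finset, Finset.card_image_of_injOn]
  intro x _ y _ hxy
  unfold posn at hxy
  rw [Prod.mk.injEq] at hxy
  omega

/-- Occupied positions on a ladder, from column `b` on. -/
def occ (m : ℕ) (μ : YPartition) (k b : ℕ) : ℕ :=
  ((colsOf m k).filter (fun c => k < fH m μ c ∧ b ≤ c)).card

lemma occ_add_LL {m : ℕ} (hm : 1 ≤ m) (μ : YPartition) (k b : ℕ) :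
    occ m μ k b + LL m μ (k + 1) b = ((colsOf m k).filter (fun c => b ≤ c)).card := by
  unfold occ LL
  rw [← Finset.card_union_of_disjoint]
  · congr 1
    ext c
    have := le_fH hm μ c
    have : m * c ≤ fH m μ c := by unfold fH; omega
    simp only [Finset.mem_union, Finset.mem_filter, Finset.mem_Ico, mem_colsOf hm]
    omega
  · rw [Finset.disjoint_left]
    intro c
    simp only [Finset.mem_filter]
    omega

lemma ladderCount_succ {ℓ m : ℕ} (hm : 1 ≤ m) (hℓ : ℓ = m + 1) (μ : YPartition) (k : ℕ) :
    ladderCount ℓ μ (k + 1) = occ m μ k 0 := by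
  classical
  have : μ.cells ∩ {p | ladderIdx ℓ p = k + 1} = μ.cells ∩ LadderPositions ℓ (k + 1) := by
    ext p
    simp only [Set.mem_inter_iff, LadderPositions, Set.mem_ofPred_eq, cells]
    tauto
  unfold ladderCount
  rw [this, ladder_ncard hm hℓ]
  unfold occ
  congr 1
  ext c
  simp only [Finset.mem_filter, mem_colsOf hm]
  constructor
  · rintro ⟨h1, h2⟩
    exact ⟨h1, (posn_mem_cells μ h1).1 h2, by omega⟩
  · rintro ⟨h1, h2, -⟩
    exact ⟨h1, (posn_mem_cells μ h1).2 h2⟩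

lemma ladderCount_zero (ℓ : ℕ) (μ : YPartition) : ladderCount ℓ μ 0 = 0 := by
  have : μ.cells ∩ {p | ladderIdx ℓ p = 0} = ∅ := by
    ext p
    simp only [Set.mem_inter_iff, Set.mem_ofPred_eq, cells, ladderIdx, Set.mem_empty_iff_false,
      iff_false]
    omega
  unfold ladderCount
  rw [this, Set.ncard_empty]

lemma sameRegClass_iff {ℓ m : ℕ} (hm : 1 ≤ m) (hℓ : ℓ = m + 1) (μ ν : YPartition) :
    SameRegClass ℓ μ ν ↔ SameCl m μ ν := by
  constructor
  · intro h K
    cases K with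
    | zero => simp [LL_zero]
    | succ k =>
      have h1 := h (k + 1)
      rw [ladderCount_succ hm hℓ, ladderCount_succ hm hℓ] at h1
      have := occ_add_LL hm μ k 0
      have := occ_add_LL hm ν k 0
      omega
  · intro h K
    cases K with
    | zero => rw [ladderCount_zero, ladderCount_zero]
    | succ k =>
      have h1 := h (k + 1)
      rw [ladderCount_succ hm hℓ, ladderCount_succ hm hℓ]
      have := occ_add_LL hm μ k 0
      have := occ_add_LL hm ν k 0
      omega

/-! ### Dominance -/

lemma sum_parts (μ : YPartition) (j : ℕ) :
    ∑ i ∈ Finset.Icc 1 j, μ.part i = ∑ i ∈ Finset.range j, μ.rw0 i := by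
  induction j with
  | zero => simp
  | succ j ih => rw [Finset.sum_Icc_succ_top (by omega), ih, Finset.sum_range_succ]; rfl

lemma sum_rows_occ {m : ℕ} (hm : 1 ≤ m) (μ : YPartition) (j N : ℕ) (hN : μ.rw0 0 ≤ N)
    (β : ℕ → ℕ) (hβ : ∀ k c, k < j + m * c ↔ β k ≤ c) :
    ∑ i ∈ Finset.range j, μ.rw0 i = ∑ k ∈ Finset.range (j + m * N), occ m μ k (β k) := by
  have h1 : ∑ i ∈ Finset.range j, μ.rw0 i =
      ((Finset.range j ×ˢ Finset.range N).filter (fun p => p.2 < μ.rw0 p.1)).card := by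
    rw [Finset.card_filter, Finset.sum_product]
    apply Finset.sum_congr rfl
    intro i _
    rw [← Finset.card_filter]
    have : (Finset.range N).filter (fun c => c < μ.rw0 i) = Finset.range (μ.rw0 i) := by
      ext c
      have := μ.rw0_anti (Nat.zero_le i)
      simp only [Finset.mem_filter, Finset.mem_range]
      omega
    rw [this, Finset.card_range]
  rw [h1, Finset.card_eq_sum_card_fiberwise (f := fun p : ℕ × ℕ => p.1 + m * p.2)
    (t := Finset.range (j + m * N))]
  · apply Finset.sum_congr rfl
    intro k _
    unfold occ
    refine Finset.card_bij' (fun p _ => p.2) (fun c _ => (k - m * c, c)) ?_ ?_ ?_ ?_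
    · rintro ⟨i, c⟩ h
      simp only [Finset.mem_filter, Finset.mem_product, Finset.mem_range, mem_colsOf hm] at h ⊢
      obtain ⟨⟨⟨h1, h2⟩, h3⟩, h4⟩ := h
      rw [lt_cl0_iff] at h3
      unfold fH
      exact ⟨by omega, by omega, (hβ k c).1 (by omega)⟩
    · intro c h
      simp only [Finset.mem_filter, Finset.mem_product, Finset.mem_range, mem_colsOf hm] at h ⊢
      obtain ⟨h1, h2, h3⟩ := h
      have h4 := (hβ k c).2 h3
      have h5 : c < μ.rw0 (k - m * c) := by
        rw [lt_cl0_iff]; unfold fH at h2; omega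
      have := μ.rw0_anti (Nat.zero_le (k - m * c))
      exact ⟨⟨⟨by omega, by omega⟩, h5⟩, by omega⟩
    · rintro ⟨i, c⟩ h
      simp only [Finset.mem_filter] at h
      have h4 : i + m * c = k := h.2
      exact Prod.ext (show k - m * c = i by omega) rfl
    · intro c h
      rfl
  · rintro ⟨i, c⟩ h
    simp only [Finset.coe_filter, Set.mem_ofPred_eq, Finset.mem_product, Finset.mem_range,
      Finset.coe_range, Set.mem_Iio] at h ⊢
    have := Nat.mul_le_mul_left m h.1.2.le
    omega

lemma Below.domLE {m : ℕ} (hm : 1 ≤ m) {ν ρ : YPartition} (h : Below m ν ρ) : DomLE ν ρ := by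
  intro j
  rw [sum_parts, sum_parts]
  have hex : ∀ k, ∃ b, ∀ c, k < j + m * c ↔ b ≤ c := by
    intro k
    have hk : ∃ b, k < j + m * b := ⟨k + 1, by
      have : k + 1 ≤ m * (k + 1) := Nat.le_mul_of_pos_left _ hm
      omega⟩
    refine ⟨Nat.find hk, fun c => ⟨fun hc => Nat.find_min' hk hc, fun hc => ?_⟩⟩
    have h1 := Nat.find_spec hk
    have := Nat.mul_le_mul_left m hc
    omega
  choose β hβ using hex
  rw [sum_rows_occ hm ν j (ν.rw0 0 + ρ.rw0 0) (by omega) β hβ,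
    sum_rows_occ hm ρ j (ν.rw0 0 + ρ.rw0 0) (by omega) β hβ]
  apply Finset.sum_le_sum
  intro k _
  have := occ_add_LL hm ν k (β k)
  have := occ_add_LL hm ρ k (β k)
  have := h (k + 1) (β k)
  omega

lemma domLE_antisymm {μ ν : YPartition} (h1 : DomLE μ ν) (h2 : DomLE ν μ) : μ = ν := by
  apply ext_rw0
  intro i
  have e : ∀ j, ∑ i ∈ Finset.range j, μ.rw0 i = ∑ i ∈ Finset.range j, ν.rw0 i := by
    intro j
    rw [← sum_parts, ← sum_parts]
    exact le_antisymm (h1 j) (h2 j)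
  have a := e i
  have b := e (i + 1)
  rw [Finset.sum_range_succ, Finset.sum_range_succ] at b
  omega

/-! ### Rank selection in finite sets of naturals -/

lemma rank_card (Q : Finset ℕ) (n : ℕ) :
    (Q.filter (fun c => (Q.filter (fun q => q < c)).card < n)).card = min n Q.card := by
  induction Q using Finset.induction_on_max with
  | empty => simp
  | insert a s hs ih =>
    have ha : a ∉ s := fun h => lt_irrefl _ (hs a h)
    have hra : (insert a s).filter (fun q => q < a) = s := by
      ext q
      simp only [Finset.mem_filter, Finset.mem_insert]
      constructor
      · rintro ⟨rfl | h, h2⟩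
        · omega
        · exact h
      · intro h; exact ⟨Or.inr h, hs q h⟩
    have hrs : ∀ c ∈ s, (insert a s).filter (fun q => q < c) = s.filter (fun q => q < c) := by
      intro c hc
      have := hs c hc
      rw [Finset.filter_insert, if_neg (by omega)]
    have hc : s.filter (fun c => ((insert a s).filter (fun q => q < c)).card < n) =
        s.filter (fun c => (s.filter (fun q => q < c)).card < n) := by
      apply Finset.filter_congr
      intro c hc
      rw [hrs c hc]
    rw [Finset.filter_insert, hra, hc, Finset.card_insert_of_notMem ha]
    split_ifs with h
    · rw [Finset.card_insert_of_notMem (by simp [ha]), ih]; omega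
    · rw [ih]; omega

lemma rank_min (Q Z : Finset ℕ) (n b : ℕ) (hZ : Z ⊆ Q) (hn : Z.card = n) :
    ((Q.filter (fun c => (Q.filter (fun q => q < c)).card < n)).filter (fun c => b ≤ c)).card ≤
      (Z.filter (fun c => b ≤ c)).card := by
  set T := Q.filter (fun c => (Q.filter (fun q => q < c)).card < n) with hT
  have hTn : T.card = n := by
    rw [hT, rank_card]
    have := Finset.card_le_card hZ
    omega
  by_cases h : (Q.filter (fun q => q < b)).card < n
  · have hsub : Z.filter (fun c => ¬ b ≤ c) ⊆ T.filter (fun c => ¬ b ≤ c) := by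
      intro c hc
      simp only [Finset.mem_filter, hT] at hc ⊢
      refine ⟨⟨hZ hc.1, lt_of_le_of_lt (Finset.card_le_card ?_) h⟩, hc.2⟩
      intro q
      simp only [Finset.mem_filter]
      rintro ⟨h1, h2⟩
      exact ⟨h1, by omega⟩
    have h1 := Finset.card_le_card hsub
    have h2 := Finset.card_filter_add_card_filter_not (s := Z) (fun c => b ≤ c)
    have h3 := Finset.card_filter_add_card_filter_not (s := T) (fun c => b ≤ c)
    omega
  · have : T.filter (fun c => b ≤ c) = ∅ := by
      ext c
      simp only [Finset.mem_filter, hT, Finset.notMem_empty, iff_false]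
      rintro ⟨⟨h1, h2⟩, h3⟩
      apply h
      refine lt_of_le_of_lt (Finset.card_le_card ?_) h2
      intro q
      simp only [Finset.mem_filter]
      rintro ⟨h1, h2⟩
      exact ⟨h1, by omega⟩
    rw [this]; simp

end YPartition

namespace YPartition

/-! ### Structure of locked boxes -/

lemma sameLadder_iff (m a b x d : ℕ) :
    SameLadder (m + 1) (a, b) (x, d) ↔ x + m * d = a + m * b := by
  unfold SameLadder
  push_cast
  constructor
  · intro h
    zify
    linarith
  · intro h
    zify at h
    linarith

lemma clear_ne {m : ℕ} (μ : YPartition) (i b c : ℕ) (hb : b ≤ μ.rw0 i)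
    (h : LadderClear (m + 1) μ (i + 1) b) (hc : c < b) : fH m μ c + m ≠ i + m * b := by
  intro hcon
  have h1 : i < μ.cl0 c := (μ.lt_cl0_iff i c).1 (by omega)
  refine h (μ.cl0 c + 1) (c + 1) (by omega) (by omega) ?_ (by omega) ?_ ?_
  · rw [sameLadder_iff]
    unfold fH at hcon
    rw [mul_add]
    omega
  · rw [mem_cells0, lt_cl0_iff]; omega
  · have := (μ.mem_cells0 (μ.cl0 c - 1) c).2 ((μ.lt_cl0_iff _ c).2 (by omega))
    rwa [Nat.sub_add_cancel (by omega)] at this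

lemma clear_of_ne {m : ℕ} (hm : 1 ≤ m) (μ : YPartition) (i b : ℕ)
    (h : ∀ c, c < b → fH m μ c + m ≠ i + m * b) : LadderClear (m + 1) μ (i + 1) b := by
  intro x d hx hd hl hlt hn hin
  rw [sameLadder_iff] at hl
  obtain ⟨c, rfl⟩ : ∃ c, d = c + 1 := ⟨d - 1, by omega⟩
  obtain ⟨y, rfl⟩ : ∃ y, x = y + 2 := ⟨x - 2, by omega⟩
  rw [show y + 2 - 1 = y + 1 by omega, mem_cells0, lt_cl0_iff] at hin
  rw [show y + 2 = y + 1 + 1 by omega, mem_cells0, lt_cl0_iff] at hn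
  have hcb : c < b := by
    by_contra hcon
    have := Nat.mul_le_mul_left m (show b ≤ c + 1 by omega)
    omega
  refine h c hcb ?_
  unfold fH
  rw [mul_add] at hl
  omega

lemma Locked.mem {ℓ : ℕ} {μ : YPartition} {p : ℕ × ℕ} (h : Locked ℓ μ p) : p ∈ μ.cells := by
  cases h <;> assumption

lemma Locked.up_aux {ℓ : ℕ} {μ : YPartition} {p : ℕ × ℕ} (h : Locked ℓ μ p) :
    ∀ a, p.1 = a + 2 → Locked ℓ μ (a + 1, p.2) := by
  induction h with
  | typeI_top b h1 h2 => intro a ha; simp at ha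
  | typeI_up a' b h1 h2 h3 _ =>
    intro a ha
    have : a' = a + 1 := by simpa using ha
    subst this
    exact h2
  | typeII a' b b' h1 h2 h3 ih =>
    intro a ha
    have ha' : a' = a + 2 := ha
    subst ha'
    refine Locked.typeII _ _ b' ?_ h2 (ih a rfl)
    obtain ⟨g1, g2, g3⟩ := h1
    refine ⟨by simp, g2, ?_⟩
    have := μ.antitone (a + 1) (a + 2) (by omega) (by omega)
    exact le_trans g3 this

lemma Locked.up {ℓ : ℕ} {μ : YPartition} {a b : ℕ} (h : Locked ℓ μ (a + 2, b)) :
    Locked ℓ μ (a + 1, b) := h.up_aux a rfl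

lemma Locked.end_clear {ℓ : ℕ} {μ : YPartition} {a b : ℕ} (h : Locked ℓ μ (a, b))
    (hmax : ∀ b', b < b' → ¬ Locked ℓ μ (a, b')) : LadderClear ℓ μ a b := by
  cases h with
  | typeI_top _ h1 h2 => exact h2
  | typeI_up _ _ h1 h2 h3 => exact h3
  | typeII _ _ b' h1 h2 h3 => exact absurd h3 (hmax b' h2)

lemma Greedy.locked {m : ℕ} (hm : 1 ≤ m) {μ : YPartition} (h : Greedy m μ) :
    ∀ i c, c < μ.rw0 i → Locked (m + 1) μ (i + 1, c + 1) := by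
  intro i
  induction i with
  | zero =>
    intro c hc
    have hend : Locked (m + 1) μ (1, μ.rw0 0) := by
      refine Locked.typeI_top _ ⟨le_rfl, by show 1 ≤ μ.rw0 0; omega, le_rfl⟩ ?_
      refine clear_of_ne hm μ 0 _ fun d hd => h 0 d hd
    rcases Nat.eq_or_lt_of_le (show c + 1 ≤ μ.rw0 0 by omega) with h1 | h1
    · rw [h1]; exact hend
    · exact Locked.typeII _ _ _ ((μ.mem_cells0 0 c).2 hc) h1 hend
  | succ i ih =>
    intro c hc
    have hend : Locked (m + 1) μ (i + 1 + 1, μ.rw0 (i + 1)) := by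
      refine Locked.typeI_up _ _ ⟨by simp, by show 1 ≤ μ.rw0 (i + 1); omega, le_rfl⟩ ?_ ?_
      · have := ih (μ.rw0 (i + 1) - 1) (by
          have := μ.rw0_anti (show i ≤ i + 1 by omega)
          omega)
        rwa [Nat.sub_add_cancel (by omega)] at this
      · refine clear_of_ne hm μ (i + 1) _ fun d hd => h (i + 1) d hd
    rcases Nat.eq_or_lt_of_le (show c + 1 ≤ μ.rw0 (i + 1) by omega) with h1 | h1
    · rw [h1]; exact hend
    · exact Locked.typeII _ _ _ ((μ.mem_cells0 (i + 1) c).2 hc) h1 hend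

lemma greedy_of_locked {m : ℕ} {μ : YPartition}
    (h : ∀ p ∈ μ.cells, Locked (m + 1) μ p) : Greedy m μ := by
  intro i c hc
  have hend : Locked (m + 1) μ (i + 1, μ.rw0 i) :=
    h _ ⟨by simp, by show 1 ≤ μ.rw0 i; omega, le_rfl⟩
  have hcl := hend.end_clear (by
    intro b' hb' hl
    have h1 : b' ≤ μ.rw0 i := hl.mem.2.2
    omega)
  exact clear_ne μ i _ c le_rfl hcl hc

open Classical in
/-- Number of locked boxes in row `i`. -/
def zz (ℓ : ℕ) (μ : YPartition) (i : ℕ) : ℕ :=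
  Nat.findGreatest (fun b => Locked ℓ μ (i + 1, b)) (μ.rw0 i)

lemma zz_le (ℓ : ℕ) (μ : YPartition) (i : ℕ) : zz ℓ μ i ≤ μ.rw0 i := by
  classical
  exact Nat.findGreatest_le _

lemma zz_locked {ℓ : ℕ} {μ : YPartition} {i : ℕ} (h : zz ℓ μ i ≠ 0) :
    Locked ℓ μ (i + 1, zz ℓ μ i) := by
  classical
  exact Nat.findGreatest_of_ne_zero (P := fun b => Locked ℓ μ (i + 1, b)) rfl h

lemma le_zz {ℓ : ℕ} {μ : YPartition} {i b : ℕ} (h : Locked ℓ μ (i + 1, b)) : b ≤ zz ℓ μ i := by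
  classical
  exact Nat.le_findGreatest (P := fun b => Locked ℓ μ (i + 1, b)) h.mem.2.2 h

lemma zz_anti (ℓ : ℕ) (μ : YPartition) (i : ℕ) : zz ℓ μ (i + 1) ≤ zz ℓ μ i := by
  by_cases h : zz ℓ μ (i + 1) = 0
  · omega
  · exact le_zz (Locked.up (zz_locked h))

lemma zz_clear {m : ℕ} (μ : YPartition) (i c : ℕ) (h : c < zz (m + 1) μ i) :
    fH m μ c + m ≠ i + m * zz (m + 1) μ i := by
  refine clear_ne μ i _ c (zz_le _ _ _) ?_ h
  refine (zz_locked (by omega)).end_clear ?_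
  intro b' hb' hl
  have := le_zz hl
  omega

/-- Locked boxes survive in everything lying ladderwise below. -/
lemma locked_survive {m : ℕ} (hm : 1 ≤ m) {lam ρ : YPartition} (h1 : SameCl m lam ρ)
    (h2 : Below m ρ lam) : lockedCells (m + 1) lam ⊆ ρ.cells := by
  rintro ⟨a, b⟩ hp
  have hp' : Locked (m + 1) lam (a, b) := hp
  obtain ⟨g1, g2, g3⟩ := hp'.mem
  simp only at g1 g2
  obtain ⟨i, rfl⟩ : ∃ i, a = i + 1 := ⟨a - 1, by omega⟩
  have := clear_survives hm h1 h2 (zz (m + 1) lam) (zz_anti _ _)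
    (fun i c h => zz_clear lam i c h) i
  exact ⟨g1, g2, (le_zz hp').trans this⟩

/-! ### The diagram `S λ` -/

open Classical in
/-- Columns of ladder `k` with a locked box. -/
def lockCols (m : ℕ) (lam : YPartition) (k : ℕ) : Finset ℕ :=
  (colsOf m k).filter (fun c => posn m k c ∈ lockedCells (m + 1) lam)

open Classical in
/-- Columns of ladder `k` without a locked box. -/
def freeCols (m : ℕ) (lam : YPartition) (k : ℕ) : Finset ℕ :=
  (colsOf m k).filter (fun c => posn m k c ∉ lockedCells (m + 1) lam)

lemma occ_split {m : ℕ} (hm : 1 ≤ m) {lam μ : YPartition}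
    (h : lockedCells (m + 1) lam ⊆ μ.cells) (k b : ℕ) :
    occ m μ k b = ((lockCols m lam k).filter (fun c => b ≤ c)).card +
      (((freeCols m lam k).filter (fun c => k < fH m μ c)).filter (fun c => b ≤ c)).card := by
  unfold occ
  rw [← Finset.card_union_of_disjoint]
  · congr 1
    ext c
    simp only [Finset.mem_filter, Finset.mem_union, lockCols, freeCols]
    have h1 : c ∈ colsOf m k → posn m k c ∈ lockedCells (m + 1) lam → k < fH m μ c := by
      intro g1 g2
      rw [mem_colsOf hm] at g1
      exact (posn_mem_cells μ g1).1 (h g2)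
    tauto
  · rw [Finset.disjoint_left]
    intro c
    simp only [Finset.mem_filter, lockCols, freeCols]
    tauto

lemma unlocked_card {m : ℕ} (hm : 1 ≤ m) (lam : YPartition) (k : ℕ) :
    unlockedCount (m + 1) lam (k + 1) =
      ((freeCols m lam k).filter (fun c => k < fH m lam c)).card := by
  classical
  unfold unlockedCount
  have : (lam.cells ∩ LadderPositions (m + 1) (k + 1)) \ lockedCells (m + 1) lam =
      (lam.cells \ lockedCells (m + 1) lam) ∩ LadderPositions (m + 1) (k + 1) := by
    ext p
    simp only [Set.mem_inter_iff, Set.mem_sdiff]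
    tauto
  rw [this, ladder_ncard hm rfl]
  congr 1
  ext c
  simp only [Finset.mem_filter, freeCols, Set.mem_sdiff, mem_colsOf hm]
  have h1 : m * c ≤ k → (posn m k c ∈ lam.cells ↔ k < fH m lam c) := posn_mem_cells lam
  tauto

lemma mem_SCells {m : ℕ} (hm : 1 ≤ m) (lam : YPartition) (k c : ℕ) (hc : m * c ≤ k)
    (hL : posn m k c ∉ lockedCells (m + 1) lam) :
    posn m k c ∈ SCells (m + 1) lam ↔
      ((freeCols m lam k).filter (fun q => q < c)).card <
        ((freeCols m lam k).filter (fun c => k < fH m lam c)).card := by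
  classical
  have hidx : ladderIdx (m + 1) (posn m k c) = k + 1 := by
    unfold ladderIdx posn
    simp only [Nat.add_sub_cancel]
    omega
  unfold SCells
  simp only [Set.mem_union, Set.mem_ofPred_eq]
  rw [hidx, unlocked_card hm]
  have : (LadderPositions (m + 1) (k + 1) ∩ {q | (posn m k c).1 < q.1}) \
      lockedCells (m + 1) lam =
      ({q | (posn m k c).1 < q.1} \ lockedCells (m + 1) lam) ∩
        LadderPositions (m + 1) (k + 1) := by
    ext p
    simp only [Set.mem_inter_iff, Set.mem_sdiff]
    tauto
  have h2 : ((LadderPositions (m + 1) (k + 1) ∩ {q | (posn m k c).1 < q.1}) \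
      lockedCells (m + 1) lam).ncard =
      ((freeCols m lam k).filter (fun q => q < c)).card := by
    rw [this, ladder_ncard hm rfl]
    congr 1
    ext c'
    simp only [Finset.mem_filter, freeCols, Set.mem_sdiff, mem_colsOf hm, Set.mem_ofPred_eq]
    have : m * c' ≤ k → ((posn m k c).1 < (posn m k c').1 ↔ c' < c) := by
      intro hc'
      unfold posn
      simp only
      constructor
      · intro h
        by_contra hcon
        have := Nat.mul_le_mul_left m (show c ≤ c' by omega)
        omega
      · intro h
        have := Nat.mul_lt_mul_of_pos_left h hm
        omega
    tauto
  rw [h2]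
  have h3 : 1 ≤ (posn m k c).1 := by unfold posn; simp
  have h4 : 1 ≤ (posn m k c).2 := by unfold posn; simp
  tauto

lemma sl_free {m : ℕ} (hm : 1 ≤ m) {lam sl : YPartition} (hS : sl.cells = SCells (m + 1) lam)
    (k : ℕ) : (freeCols m lam k).filter (fun c => k < fH m sl c) =
      (freeCols m lam k).filter (fun c => ((freeCols m lam k).filter (fun q => q < c)).card <
        ((freeCols m lam k).filter (fun c => k < fH m lam c)).card) := by
  apply Finset.filter_congr
  intro c hc
  simp only [freeCols, Finset.mem_filter, mem_colsOf hm] at hc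
  rw [← posn_mem_cells sl hc.1, hS, mem_SCells hm lam k c hc.1 hc.2]

lemma locked_sub_sl {ℓ : ℕ} {lam sl : YPartition} (hS : sl.cells = SCells ℓ lam) :
    lockedCells ℓ lam ⊆ sl.cells := by
  rw [hS]; exact Set.subset_union_left

lemma locked_sub_lam (ℓ : ℕ) (lam : YPartition) : lockedCells ℓ lam ⊆ lam.cells :=
  fun _ h => Locked.mem h

lemma sl_sameCl {m : ℕ} (hm : 1 ≤ m) {lam sl : YPartition}
    (hS : sl.cells = SCells (m + 1) lam) : SameCl m lam sl := by
  intro K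
  cases K with
  | zero => simp [LL_zero]
  | succ k =>
    have h1 := occ_split hm (locked_sub_sl hS) k 0
    have h2 := occ_split hm (locked_sub_lam (m + 1) lam) k 0
    rw [sl_free hm hS] at h1
    simp only [Nat.zero_le, Finset.filter_true] at h1 h2
    rw [rank_card, min_eq_left (Finset.card_filter_le _ _)] at h1
    have := occ_add_LL hm lam k 0
    have := occ_add_LL hm sl k 0
    omega

lemma sl_below {m : ℕ} (hm : 1 ≤ m) {lam sl ν : YPartition}
    (hS : sl.cells = SCells (m + 1) lam) (hν : SameCl m lam ν)
    (hsub : lockedCells (m + 1) lam ⊆ ν.cells) : Below m sl ν := by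
  intro K b
  cases K with
  | zero => simp [LL_zero]
  | succ k =>
    have h1 := occ_split hm hsub k 0
    have h2 := occ_split hm (locked_sub_lam (m + 1) lam) k 0
    simp only [Nat.zero_le, Finset.filter_true] at h1 h2
    have h3 := occ_add_LL hm lam k 0
    have h4 := occ_add_LL hm ν k 0
    have h5 := hν (k + 1)
    have h6 := rank_min (freeCols m lam k) ((freeCols m lam k).filter (fun c => k < fH m ν c))
      ((freeCols m lam k).filter (fun c => k < fH m lam c)).card b (Finset.filter_subset _ _)
      (by omega)
    rw [← sl_free hm hS] at h6
    have h7 := occ_split hm (locked_sub_sl hS) k b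
    have h8 := occ_split hm hsub k b
    have := occ_add_LL hm ν k b
    have := occ_add_LL hm sl k b
    omega

lemma sl_greedy {m : ℕ} (hm : 1 ≤ m) {lam sl : YPartition}
    (hS : sl.cells = SCells (m + 1) lam) : Greedy m sl := by
  obtain ⟨ν, h1, h2⟩ := exists_greedy hm lam
  have h3 := greedy_below hm h2 h1.symm
  have h4 := greedy_below hm h2 (h1.symm.trans (sl_sameCl hm hS))
  have h5 := sl_below hm hS h1 (locked_survive hm h1 h3)
  rw [Below.eq hm h5 h4]
  exact h2

end YPartition

/-- `Sλ` is the unique smallest partition in the regularization class of `λ`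
with respect to dominance order, and the unique partition in this class all of whose boxes
are locked. -/
theorem statement8 (ℓ : ℕ) (hℓ : 2 < ℓ) (lam sl : YPartition)
    (hS : sl.cells = SCells ℓ lam) :
    SameRegClass ℓ lam sl ∧
    (∀ nu : YPartition, SameRegClass ℓ lam nu → DomLE sl nu) ∧
    (∀ nu : YPartition, SameRegClass ℓ lam nu →
      (∀ ρ : YPartition, SameRegClass ℓ lam ρ → DomLE nu ρ) → nu = sl) ∧
    (∀ p ∈ sl.cells, Locked ℓ sl p) ∧
    (∀ nu : YPartition, SameRegClass ℓ lam nu →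
      (∀ p ∈ nu.cells, Locked ℓ nu p) → nu = sl) := by
  obtain ⟨m, rfl⟩ : ∃ m, ℓ = m + 1 := ⟨ℓ - 1, by omega⟩
  have hm : 1 ≤ m := by omega
  have hc := sl_sameCl hm hS
  have hg := sl_greedy hm hS
  have hreg := (sameRegClass_iff hm rfl lam sl).2 hc
  have hmin : ∀ nu : YPartition, SameRegClass (m + 1) lam nu → DomLE sl nu := by
    intro nu hnu
    rw [sameRegClass_iff hm rfl] at hnu
    exact (greedy_below hm hg (hc.symm.trans hnu)).domLE hm
  refine ⟨hreg, hmin, ?_, ?_, ?_⟩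
  · intro nu hnu h
    exact domLE_antisymm (h sl hreg) (hmin nu hnu)
  · rintro ⟨a, b⟩ hp
    obtain ⟨g1, g2, -⟩ := id hp
    simp only at g1 g2
    obtain ⟨i, rfl⟩ : ∃ i, a = i + 1 := ⟨a - 1, by omega⟩
    obtain ⟨c, rfl⟩ : ∃ c, b = c + 1 := ⟨b - 1, by omega⟩
    exact hg.locked hm i c ((sl.mem_cells0 i c).1 hp)
  · intro nu hnu h
    rw [sameRegClass_iff hm rfl] at hnu
    have hgn := greedy_of_locked h
    exact Below.eq hm (greedy_below hm hgn (hnu.symm.trans hc))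
      (greedy_below hm hg (hc.symm.trans hnu))
end
end

section
/- Fix an integer ℓ > 2. If a partition λ is a node of the ladder crystal B(Λ0)^L, then λ is the smallest partition, with respect to dominance order, in its regularization class. -/
noncomputable section

open YPartition
/-- No row end lies above (on its ladder) an empty position sitting just below a column. -/
def Star9 (L : ℕ) (f : ℕ → ℕ) : Prop :=
  ∀ a c d t : ℕ, 1 ≤ a → 1 ≤ d → 1 ≤ t → a + L * t = c + 1 → f a = d + t →
    f (c + 1) < d → f c < d

/-- cells of ladder `k` in rows `≤ j`. -/
def topF (L : ℕ) (f : ℕ → ℕ) (k j : ℕ) : Finset (ℕ × ℕ) :=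
  (Finset.Icc 1 j ×ˢ Finset.Icc 1 k).filter fun p => p.2 ≤ f p.1 ∧ p.1 + L * p.2 = k + L

/-- cells of ladder `k` in rows `> j`. -/
def botF (L : ℕ) (f : ℕ → ℕ) (k j : ℕ) : Finset (ℕ × ℕ) :=
  (Finset.Icc (j + 1) k ×ˢ Finset.Icc 1 k).filter fun p => p.2 ≤ f p.1 ∧ p.1 + L * p.2 = k + L

theorem ladder_bounds {L a b k : ℕ} (hL : 2 ≤ L) (ha : 1 ≤ a) (hb : 1 ≤ b)
    (h : a + L * b = k + L) : a ≤ k ∧ b ≤ k := by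
  obtain ⟨b, rfl⟩ := Nat.exists_eq_add_of_le hb
  have : 2 * b ≤ L * b := Nat.mul_le_mul_right _ hL
  have e : L * (1 + b) = L + L * b := by ring
  omega

theorem mem_topF {L : ℕ} (hL : 2 ≤ L) {f : ℕ → ℕ} {k j a b : ℕ} :
    (a, b) ∈ topF L f k j ↔ 1 ≤ a ∧ a ≤ j ∧ 1 ≤ b ∧ b ≤ f a ∧ a + L * b = k + L := by
  simp only [topF, Finset.mem_filter, Finset.mem_product, Finset.mem_Icc]
  constructor
  · rintro ⟨⟨⟨h1, h2⟩, h3, h4⟩, h5, h6⟩; exact ⟨h1, h2, h3, h5, h6⟩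
  · rintro ⟨h1, h2, h3, h5, h6⟩
    exact ⟨⟨⟨h1, h2⟩, h3, (ladder_bounds hL h1 h3 h6).2⟩, h5, h6⟩

theorem mem_botF {L : ℕ} (hL : 2 ≤ L) {f : ℕ → ℕ} {k j a b : ℕ} :
    (a, b) ∈ botF L f k j ↔ j + 1 ≤ a ∧ 1 ≤ b ∧ b ≤ f a ∧ a + L * b = k + L := by
  simp only [botF, Finset.mem_filter, Finset.mem_product, Finset.mem_Icc]
  constructor
  · rintro ⟨⟨⟨h1, h2⟩, h3, h4⟩, h5, h6⟩; exact ⟨h1, h3, h5, h6⟩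
  · rintro ⟨h1, h3, h5, h6⟩
    have := ladder_bounds hL (by omega) h3 h6
    exact ⟨⟨⟨h1, this.1⟩, h3, this.2⟩, h5, h6⟩

theorem ladder_nat {ℓ a b k : ℕ} (hb : 1 ≤ b) :
    a + (ℓ - 1) * (b - 1) = k ↔ a + (ℓ - 1) * b = k + (ℓ - 1) := by
  obtain ⟨b, rfl⟩ := Nat.exists_eq_add_of_le hb
  have e : (ℓ - 1) * (1 + b) = (ℓ - 1) + (ℓ - 1) * b := by ring
  simp only [Nat.add_sub_cancel_left]
  omega

theorem ladderCount_eq {ℓ : ℕ} (hℓ : 2 < ℓ) (μ : YPartition) (k j : ℕ) :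
    ladderCount ℓ μ k = (topF (ℓ - 1) μ.part k j).card + (botF (ℓ - 1) μ.part k j).card := by
  have hL : 2 ≤ ℓ - 1 := by omega
  rw [← Finset.card_union_of_disjoint, ladderCount, ← Set.ncard_coe_finset]
  · congr 1
    ext ⟨a, b⟩
    simp only [cells, Set.mem_inter_iff, Set.mem_setOf_eq, ladderIdx, Finset.coe_union,
      Set.mem_union, Finset.mem_coe, mem_topF hL, mem_botF hL]
    constructor
    · rintro ⟨⟨h1, h2, h3⟩, h4⟩
      rw [ladder_nat h2] at h4
      by_cases h : a ≤ j
      · left; exact ⟨h1, h, h2, h3, h4⟩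
      · right; exact ⟨by omega, h2, h3, h4⟩
    · rintro (⟨h1, h, h2, h3, h4⟩ | ⟨h1, h2, h3, h4⟩)
      · exact ⟨⟨h1, h2, h3⟩, (ladder_nat h2).2 h4⟩
      · exact ⟨⟨by omega, h2, h3⟩, (ladder_nat h2).2 h4⟩
  · rw [Finset.disjoint_left]
    rintro ⟨a, b⟩ h1 h2
    rw [mem_topF hL] at h1
    rw [mem_botF hL] at h2
    omega

/-- The key comparison: a partition with `Star9` is lowest on every ladder. -/
theorem star_min {ℓ : ℕ} (hℓ : 2 < ℓ) (lam mu : YPartition) (hs : Star9 (ℓ - 1) lam.part)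
    (hc : SameRegClass ℓ lam mu) (j : ℕ) :
    ∀ k, (topF (ℓ - 1) lam.part k j).card ≤ (topF (ℓ - 1) mu.part k j).card := by
  have hL : 2 ≤ ℓ - 1 := by omega
  induction j with
  | zero => intro k; simp [topF]
  | succ j ih =>
    by_contra! hcon
    have step : ∀ k, (topF (ℓ - 1) mu.part k (j+1)).card < (topF (ℓ - 1) lam.part k (j+1)).card →
        (topF (ℓ - 1) mu.part (k + (ℓ - 1)) (j+1)).card
          < (topF (ℓ - 1) lam.part (k + (ℓ - 1)) (j+1)).card := by
      intro k hk
      obtain ⟨⟨a0, b0⟩, h0⟩ := Finset.card_pos.1 (lt_of_le_of_lt (Nat.zero_le _) hk)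
      rw [mem_topF hL] at h0
      have hb0 := ladder_bounds hL h0.1 h0.2.2.1 h0.2.2.2.2
      obtain ⟨k, rfl⟩ : ∃ k', k = k' + 1 := ⟨k - 1, by omega⟩
      have e1 := hc (k + 1)
      rw [ladderCount_eq hℓ lam _ (j+1), ladderCount_eq hℓ mu _ (j+1)] at e1
      have e2 := hc k
      rw [ladderCount_eq hℓ lam _ j, ladderCount_eq hℓ mu _ j] at e2
      have e3 := ih k
      -- moving up
      have e4 : (botF (ℓ - 1) mu.part (k+1) (j+1)).card ≤ (botF (ℓ - 1) mu.part k j).card := by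
        apply Finset.card_le_card_of_injOn (fun p => (p.1 - 1, p.2))
        · rintro ⟨a, b⟩ h
          rw [Finset.mem_coe, mem_botF hL] at h
          simp only [Finset.mem_coe]
          rw [mem_botF hL]
          have := mu.antitone (a - 1) a (by omega) (by omega)
          omega
        · rintro ⟨a, b⟩ h ⟨a', b'⟩ h' heq
          rw [Finset.mem_coe, mem_botF hL] at h h'
          simp only [Prod.mk.injEq] at heq ⊢
          omega
      -- a sub-end exists
      have e5 : ∃ c d, j + 1 ≤ c ∧ 1 ≤ d ∧ c + (ℓ - 1) * d = k + (ℓ - 1) ∧ d ≤ lam.part c ∧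
          lam.part (c + 1) < d := by
        by_contra! hno
        have : (botF (ℓ - 1) lam.part k j).card ≤ (botF (ℓ - 1) lam.part (k+1) (j+1)).card := by
          apply Finset.card_le_card_of_injOn (fun p => (p.1 + 1, p.2))
          · rintro ⟨a, b⟩ h
            rw [Finset.mem_coe, mem_botF hL] at h
            simp only [Finset.mem_coe]
            rw [mem_botF hL]
            have := hno a b (by omega) (by omega) (by omega) (by omega)
            omega
          · rintro ⟨a, b⟩ h ⟨a', b'⟩ h' heq
            simp only [Prod.mk.injEq] at heq ⊢
            omega
        omega
      obtain ⟨c, d, hc1, hd1, hcd, hdc, hdc'⟩ := e5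
      have hck := ladder_bounds hL (by omega) hd1 hcd
      have e6 : (topF (ℓ - 1) lam.part (k+1) (j+1)).card
          ≤ (topF (ℓ - 1) lam.part (k+1+(ℓ-1)) (j+1)).card := by
        apply Finset.card_le_card_of_injOn (fun p => (p.1, p.2 + 1))
        · rintro ⟨a, b⟩ h
          rw [Finset.mem_coe, mem_topF hL] at h
          simp only [Finset.mem_coe]
          rw [mem_topF hL]
          obtain ⟨h1, h2, h3, h4, h5⟩ := h
          have e : (ℓ - 1) * (b + 1) = (ℓ - 1) * b + (ℓ - 1) := by ring
          refine ⟨h1, h2, by omega, ?_, by omega⟩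
          by_contra hlt
          have hfa : lam.part a = b := by omega
          have hdb : d < b := by
            by_contra hdb
            have := Nat.mul_le_mul_left (ℓ - 1) (not_lt.1 hdb)
            omega
          obtain ⟨t, rfl⟩ := Nat.exists_eq_add_of_le hdb.le
          have e' : (ℓ - 1) * (d + t) = (ℓ - 1) * d + (ℓ - 1) * t := by ring
          have := hs a c d t h1 hd1 (by omega) (by omega) hfa hdc'
          omega
        · rintro ⟨a, b⟩ h ⟨a', b'⟩ h' heq
          simp only [Prod.mk.injEq] at heq ⊢
          omega
      have e7 : (topF (ℓ - 1) mu.part (k+1+(ℓ-1)) (j+1)).card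
          ≤ (topF (ℓ - 1) mu.part (k+1) (j+1)).card := by
        apply Finset.card_le_card_of_injOn (fun p => (p.1, p.2 - 1))
        · rintro ⟨a, b⟩ h
          rw [Finset.mem_coe, mem_topF hL] at h
          simp only [Finset.mem_coe]
          rw [mem_topF hL]
          obtain ⟨h1, h2, h3, h4, h5⟩ := h
          have hb : 2 ≤ b := by
            by_contra hb
            have : b = 1 := by omega
            subst this
            omega
          obtain ⟨b, rfl⟩ : ∃ b', b = b' + 1 := ⟨b - 1, by omega⟩
          have e : (ℓ - 1) * (b + 1) = (ℓ - 1) * b + (ℓ - 1) := by ring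
          simp only [Nat.add_sub_cancel]
          omega
        · rintro ⟨a, b⟩ h ⟨a', b'⟩ h' heq
          rw [Finset.mem_coe, mem_topF hL] at h h'
          simp only [Prod.mk.injEq] at heq ⊢
          omega
      omega
    obtain ⟨k, hk⟩ := hcon
    have all : ∀ n, (topF (ℓ - 1) mu.part (k + n * (ℓ - 1)) (j+1)).card
          < (topF (ℓ - 1) lam.part (k + n * (ℓ - 1)) (j+1)).card := by
      intro n
      induction n with
      | zero => simpa using hk
      | succ n ihn =>
        have := step _ ihn
        rwa [show k + n * (ℓ - 1) + (ℓ - 1) = k + (n + 1) * (ℓ - 1) by ring] at this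
    have h := all (j + 1 + lam.part 1)
    obtain ⟨⟨a, b⟩, h0⟩ := Finset.card_pos.1 (lt_of_le_of_lt (Nat.zero_le _) h)
    rw [mem_topF hL] at h0
    obtain ⟨h1, h2, h3, h4, h5⟩ := h0
    have h6 := lam.antitone 1 a le_rfl h1
    have h7 : (ℓ - 1) * b ≤ (ℓ - 1) * lam.part 1 := Nat.mul_le_mul_left _ (by omega)
    have h8 : (j + 1) * 2 ≤ (j+1) * (ℓ - 1) := Nat.mul_le_mul_left _ hL
    have e : (j + 1 + lam.part 1) * (ℓ - 1) = (j+1) * (ℓ - 1) + (ℓ - 1) * lam.part 1 := by ring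
    omega

theorem sum_eq_ladders {ℓ : ℕ} (hℓ : 2 < ℓ) (μ : YPartition) (j K : ℕ)
    (hK : j + (ℓ - 1) * μ.part 1 < K) :
    ∑ i ∈ Finset.Icc 1 j, μ.part i = ∑ k ∈ Finset.range K, (topF (ℓ - 1) μ.part k j).card := by
  have hL : 2 ≤ ℓ - 1 := by omega
  let S : Finset (ℕ × ℕ) :=
    (Finset.Icc 1 j ×ˢ Finset.Icc 1 (μ.part 1)).filter fun p => p.2 ≤ μ.part p.1
  have hS : ∀ a b, (a, b) ∈ S ↔ 1 ≤ a ∧ a ≤ j ∧ 1 ≤ b ∧ b ≤ μ.part a := by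
    intro a b
    simp only [S, Finset.mem_filter, Finset.mem_product, Finset.mem_Icc]
    constructor
    · rintro ⟨⟨⟨h1, h2⟩, h3, h4⟩, h5⟩; exact ⟨h1, h2, h3, h5⟩
    · rintro ⟨h1, h2, h3, h4⟩
      have := μ.antitone 1 a le_rfl h1
      exact ⟨⟨⟨h1, h2⟩, h3, by omega⟩, h4⟩
  have c1 : S.card = ∑ i ∈ Finset.Icc 1 j, μ.part i := by
    rw [Finset.card_eq_sum_card_fiberwise (f := Prod.fst) (t := Finset.Icc 1 j)]
    · apply Finset.sum_congr rfl
      intro i hi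
      rw [Finset.mem_Icc] at hi
      have : S.filter (fun p => p.1 = i) = (Finset.Icc 1 (μ.part i)).image (fun b => (i, b)) := by
        ext ⟨a, b⟩
        simp only [Finset.mem_filter, hS, Finset.mem_image, Finset.mem_Icc, Prod.mk.injEq]
        constructor
        · rintro ⟨⟨h1, h2, h3, h4⟩, rfl⟩; exact ⟨b, ⟨h3, h4⟩, rfl, rfl⟩
        · rintro ⟨b', ⟨h3, h4⟩, rfl, rfl⟩; exact ⟨⟨hi.1, hi.2, h3, h4⟩, rfl⟩
      rw [this, Finset.card_image_of_injective _ (fun x y h => by simpa using h)]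
      simp
    · rintro ⟨a, b⟩ h
      rw [Finset.mem_coe, hS] at h
      simp only [Finset.coe_Icc, Set.mem_Icc]
      omega
  have c2 : S.card = ∑ k ∈ Finset.range K, (topF (ℓ - 1) μ.part k j).card := by
    rw [Finset.card_eq_sum_card_fiberwise (f := fun p => p.1 + (ℓ - 1) * (p.2 - 1))
      (t := Finset.range K)]
    · apply Finset.sum_congr rfl
      intro k hk
      congr 1
      ext ⟨a, b⟩
      simp only [Finset.mem_filter, hS, mem_topF hL]
      constructor
      · rintro ⟨⟨h1, h2, h3, h4⟩, h5⟩; exact ⟨h1, h2, h3, h4, (ladder_nat h3).1 h5⟩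
      · rintro ⟨h1, h2, h3, h4, h5⟩; exact ⟨⟨h1, h2, h3, h4⟩, (ladder_nat h3).2 h5⟩
    · rintro ⟨a, b⟩ h
      rw [Finset.mem_coe, hS] at h
      have := μ.antitone 1 a le_rfl h.1
      have : (ℓ - 1) * (b - 1) ≤ (ℓ - 1) * μ.part 1 := Nat.mul_le_mul_left _ (by omega)
      simp only [Finset.coe_range, Set.mem_Iio]
      omega
  rw [← c1, c2]

theorem star_dom {ℓ : ℕ} (hℓ : 2 < ℓ) (lam mu : YPartition) (hs : Star9 (ℓ - 1) lam.part)
    (hc : SameRegClass ℓ lam mu) : DomLE lam mu := by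
  intro j
  have b1 := sum_eq_ladders hℓ lam j (j + (ℓ - 1) * lam.part 1 + (ℓ - 1) * mu.part 1 + 1) (by omega)
  have b2 := sum_eq_ladders hℓ mu j (j + (ℓ - 1) * lam.part 1 + (ℓ - 1) * mu.part 1 + 1) (by omega)
  rw [b1, b2]
  exact Finset.sum_le_sum fun k _ => star_min hℓ lam mu hs hc j k

theorem ladderLE_trans {ℓ : ℕ} {p q r : ℕ × ℕ} (h1 : LadderLE ℓ p q) (h2 : LadderLE ℓ q r) :
    LadderLE ℓ p r := by
  unfold LadderLE at *; omega

theorem add_interval_finite {ℓ i : ℕ} (hℓ : 2 < ℓ) (μ : YPartition) (s q : ℕ × ℕ) :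
    (AddableRes ℓ i μ ∩ {x | LadderLE ℓ s x ∧ LadderLE ℓ x q}).Finite := by
  apply Set.Finite.subset
    ((Finset.range (ladderIdx ℓ q + 1) ×ˢ Finset.range (ladderIdx ℓ q + 2)).finite_toSet)
  rintro ⟨a, b⟩ ⟨⟨⟨h1, h2, -⟩, -⟩, -, h3⟩
  have h4 : ladderIdx ℓ (a, b) ≤ ladderIdx ℓ q := by
    rcases h3 with h | h <;> omega
  have h5 : ladderIdx ℓ (a, b) = a + (ℓ - 1) * (b - 1) := rfl
  have h6 : 1 * (b - 1) ≤ (ℓ - 1) * (b - 1) := Nat.mul_le_mul_right _ (by omega)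
  simp only [Finset.coe_product, Finset.coe_range, Set.mem_prod, Set.mem_Iio]
  omega

/-- After the cogood box, every `+` is preceded by a `-` (after the cogood box). -/
theorem cogood_next {ℓ i : ℕ} (hℓ : 2 < ℓ) (lam : YPartition) (p q : ℕ × ℕ)
    (hp : LadderCogood ℓ i lam p) (hq : q ∈ AddableRes ℓ i lam) (hpq : LadderLT ℓ p q) :
    ∃ s ∈ RemovableRes ℓ i lam, LadderLT ℓ p s ∧ LadderLE ℓ s q := by
  by_contra! hno
  have hpq' : LadderLE ℓ p q := by unfold LadderLT at hpq; unfold LadderLE; omega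
  have hcon : LadderConormal ℓ i lam q := by
    refine ⟨hq, fun s hs hsq => ?_⟩
    by_cases hsp : LadderLE ℓ s p
    · have h1 := hp.1.2 s hs hsp
      have h2 : RemovableRes ℓ i lam ∩ {x | LadderLE ℓ s x ∧ LadderLE ℓ x q}
          = RemovableRes ℓ i lam ∩ {x | LadderLE ℓ s x ∧ LadderLE ℓ x p} := by
        ext x
        constructor
        · rintro ⟨hx, h3, h4⟩
          refine ⟨hx, h3, ?_⟩
          by_contra h5
          apply hno x hx _ h4
          unfold LadderLE at h5; unfold LadderLT; omega
        · rintro ⟨hx, h3, h4⟩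
          exact ⟨hx, h3, ladderLE_trans h4 hpq'⟩
      rw [h2]
      refine lt_of_lt_of_le h1 (Set.ncard_le_ncard ?_ (add_interval_finite hℓ lam s q))
      rintro x ⟨hx, h3, h4⟩
      exact ⟨hx, h3, ladderLE_trans h4 hpq'⟩
    · have h2 : RemovableRes ℓ i lam ∩ {x | LadderLE ℓ s x ∧ LadderLE ℓ x q} = ∅ := by
        ext x
        simp only [Set.mem_inter_iff, Set.mem_setOf_eq, Set.mem_empty_iff_false, iff_false]
        rintro ⟨hx, h3, h4⟩
        apply hno x hx _ h4
        unfold LadderLE at hsp h3; unfold LadderLT; omega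
      rw [h2, Set.ncard_empty, Set.ncard_pos (add_interval_finite hℓ lam s q)]
      exact ⟨q, hq, hsq, by unfold LadderLE; omega⟩
  have := hp.2 q hcon
  unfold LadderLT at hpq; unfold LadderLE at this; omega

theorem res_eq_iff {ℓ : ℕ} (hℓ : 2 < ℓ) {a b c d : ℕ} (hb : 1 ≤ b) (hd : 1 ≤ d) :
    res ℓ (a, b) = res ℓ (c, d) ↔
      (ℓ : ℤ) ∣ (ladderIdx ℓ (a, b) : ℤ) - (ladderIdx ℓ (c, d) : ℤ) := by
  have hl0 : (ℓ : ℤ) ≠ 0 := by omega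
  have n1 := Int.emod_nonneg ((b : ℤ) - a) hl0
  have n2 := Int.emod_nonneg ((d : ℤ) - c) hl0
  have h1 : res ℓ (a, b) = res ℓ (c, d) ↔ ((b : ℤ) - a) % ℓ = ((d : ℤ) - c) % ℓ := by
    simp only [res]; omega
  rw [h1, ← Int.ModEq, Int.modEq_iff_dvd]
  have e : (ladderIdx ℓ (a, b) : ℤ) - (ladderIdx ℓ (c, d) : ℤ)
      = ((d : ℤ) - c) - ((b : ℤ) - a) + ℓ * ((b : ℤ) - d) := by
    simp only [ladderIdx]
    push_cast [Nat.cast_sub hb, Nat.cast_sub hd, Nat.cast_sub (show 1 ≤ ℓ by omega)]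
    ring
  rw [e]
  exact (Int.dvd_add_left (Dvd.intro _ rfl)).symm

theorem part_of_insert {lam mu : YPartition} {a b : ℕ} (hp : Addable lam (a, b))
    (h : mu.cells = insert (a, b) lam.cells) :
    ∀ i, 1 ≤ i → mu.part i = if i = a then lam.part i + 1 else lam.part i := by
  intro i hi
  have key : ∀ d, 1 ≤ d → (d ≤ mu.part i ↔ (i = a ∧ d = b) ∨ d ≤ lam.part i) := by
    intro d hd
    have : (i, d) ∈ mu.cells ↔ (i, d) ∈ insert (a, b) lam.cells := by rw [h]
    simp only [cells, Set.mem_setOf_eq, Set.mem_insert_iff, Prod.mk.injEq] at this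
    tauto
  have hb : b = lam.part a + 1 := hp.2.1
  have k1 := key (mu.part i)
  have k2 := key (mu.part i + 1) (by omega)
  have k3 := key (lam.part i)
  have k4 := key (lam.part i + 1) (by omega)
  split_ifs with hia
  · subst hia; omega
  · omega

theorem star_step {ℓ i : ℕ} (hℓ : 2 < ℓ) (lam mu : YPartition) (hs : Star9 (ℓ - 1) lam.part)
    (hF : HatF ℓ i lam mu) : Star9 (ℓ - 1) mu.part := by
  have hL : 2 ≤ ℓ - 1 := by omega
  obtain ⟨⟨a0, b0⟩, hco, hcells⟩ := hF
  obtain ⟨⟨hadd, hres⟩, -⟩ := id hco.1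
  have hpart := part_of_insert hadd hcells
  obtain ⟨ha0, hb0, habove⟩ := hadd
  simp only at ha0 hb0 habove
  intro a c d t ha hd ht hac hga hgc
  have hLt : 2 * t ≤ (ℓ - 1) * t := Nat.mul_le_mul_right _ hL
  rw [hpart a ha] at hga
  rw [hpart (c+1) (by omega)] at hgc
  rw [hpart c (by omega)]
  have hgc' : lam.part (c + 1) < d := by split_ifs at hgc <;> omega
  by_cases h1 : a = a0
  · -- the new row end
    subst h1
    rw [if_pos rfl] at hga
    rw [if_neg (by omega)]
    by_contra hdc
    by_cases hq : lam.part (c + 1) + 1 = d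
    · have hqa : (c + 1, d) ∈ AddableRes ℓ i lam := by
        refine ⟨⟨by simp, by simp [hq], Or.inr (by simp; omega)⟩, ?_⟩
        rw [← hres, res_eq_iff hℓ hd (by omega)]
        have e1 : ladderIdx ℓ (a, b0) = c + 1 + (ℓ - 1) * (d - 1) := by
          unfold ladderIdx
          have : b0 - 1 = (d - 1) + t := by omega
          simp only [this, mul_add]
          omega
        rw [e1]
        simp [ladderIdx]
      have e1 : ladderIdx ℓ (a, b0) = c + 1 + (ℓ - 1) * (d - 1) := by
        unfold ladderIdx
        have : b0 - 1 = (d - 1) + t := by omega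
        simp only [this, mul_add]
        omega
      have e2 : ladderIdx ℓ (c + 1, d) = c + 1 + (ℓ - 1) * (d - 1) := rfl
      obtain ⟨⟨a', b'⟩, ⟨⟨hr1, hr2, hr3⟩, hr4⟩, hps, hsq⟩ := cogood_next hℓ lam (a, b0) (c+1, d)
        hco hqa (Or.inr ⟨by rw [e1, e2], by simp; omega⟩)
      simp only at hr1 hr2 hr3
      simp only [LadderLT, LadderLE, e1, e2] at hps hsq
      have hidx : ladderIdx ℓ (a', b') = c + 1 + (ℓ - 1) * (d - 1) := by omega
      simp only [ladderIdx] at hidx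
      have hle : a' ≤ c + 1 := by omega
      have hne : a' ≠ c + 1 := by rintro rfl; 
                                  have : d - 1 = b' - 1 := by
                                    have h := Nat.add_left_cancel hidx
                                    exact (Nat.eq_of_mul_eq_mul_left (by omega) h).symm
                                  omega
      have hdb : d < b' := by
        by_contra hdb
        have := Nat.mul_le_mul_left (ℓ - 1) (show b' - 1 ≤ d - 1 by omega)
        omega
      obtain ⟨t', rfl⟩ := Nat.exists_eq_add_of_le hdb.le
      have : d + t' - 1 = (d - 1) + t' := by omega
      rw [this, mul_add] at hidx
      have := hs a' c d t' hr1 hd (by omega) (by omega) hr2.symm hgc'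
      omega
    · have hd2 : 2 ≤ d := by omega
      have := hs a c (d - 1) t ha (by omega) ht hac (by omega) (by omega)
      omega
  · rw [if_neg h1] at hga
    have hold := hs a c d t ha hd ht hac hga hgc'
    split_ifs with h2
    · subst h2
      by_contra hdc
      have hfd : lam.part c + 1 = d := by omega
      have hb : b0 = d := by omega
      subst hb
      have hca : a < c := by
        omega
      have hup : b0 ≤ lam.part (c - 1) := by omega
      have hqadd : a = 1 ∨ b0 + t + 1 ≤ lam.part (a - 1) := by
        by_cases ha1 : a = 1
        · exact Or.inl ha1
        · right
          have hm := lam.antitone (a - 1) a (by omega) (by omega)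
          by_contra hlt
          have := hs (a - 1) (c - 1) b0 t (by omega) hd ht (by omega) (by omega)
            (by rw [show c - 1 + 1 = c by omega]; omega)
          omega
      have e1 : ladderIdx ℓ (c, b0) = c + (ℓ - 1) * (b0 - 1) := rfl
      have e2 : ladderIdx ℓ (a, b0 + t + 1) = c + (ℓ - 1) * (b0 - 1) + ℓ := by
        unfold ladderIdx
        have : b0 + t + 1 - 1 = (b0 - 1) + t + 1 := by omega
        simp only [this, mul_add]
        omega
      have hqa : (a, b0 + t + 1) ∈ AddableRes ℓ i lam := by
        refine ⟨⟨ha, by simp [hga], hqadd⟩, ?_⟩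
        rw [← hres, res_eq_iff hℓ (by omega) (by omega), e1, e2]
        push_cast
        simp
      obtain ⟨⟨a', b'⟩, ⟨⟨hr1, hr2, hr3⟩, hr4⟩, hps, hsq⟩ := cogood_next hℓ lam (c, b0)
        (a, b0 + t + 1) hco hqa (Or.inl (by rw [e1, e2]; omega))
      simp only at hr1 hr2 hr3
      rw [← hres, res_eq_iff hℓ (by omega) (by omega)] at hr4
      obtain ⟨m, hm⟩ := hr4
      simp only [LadderLT, LadderLE, e1, e2] at hps hsq hm
      have hm01 : m = 0 ∨ m = 1 := by
        have hl0 : (0 : ℤ) < ℓ := by omega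
        have m0 : 0 ≤ (ℓ : ℤ) * m := by rw [← hm]; omega
        have m1 : (ℓ : ℤ) * m ≤ ℓ * 1 := by rw [← hm]; push_cast; omega
        have := nonneg_of_mul_nonneg_right m0 hl0
        have := le_of_mul_le_mul_left m1 hl0
        omega
      rcases hm01 with rfl | rfl
      · -- the `-` is on the ladder of the cogood box
        have hidx : ladderIdx ℓ (a', b') = c + (ℓ - 1) * (b0 - 1) := by omega
        have hrow : c < a' := by omega
        simp only [ladderIdx] at hidx
        have hbb : b' < b0 := by
          by_contra hbb
          have := Nat.mul_le_mul_left (ℓ - 1) (show b0 - 1 ≤ b' - 1 by omega)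
          omega
        obtain ⟨u, rfl⟩ := Nat.exists_eq_add_of_le hbb.le
        have e3 : b' + u - 1 = (b' - 1) + u := by omega
        rw [e3, mul_add] at hidx
        have := hs a a' b' (u + t) ha (by omega) (by omega) (by rw [mul_add]; omega) (by omega)
          (by omega)
        omega
      · -- the `-` is on the ladder of the `+`
        have hidx : ladderIdx ℓ (a', b') = ladderIdx ℓ (a, b0 + t + 1) := by
          rw [e2]; omega
        have hle : a' ≤ a := by omega
        have hne : a' ≠ a := by
          rintro rfl
          simp only [ladderIdx] at hidx
          have h := Nat.eq_of_mul_eq_mul_left (by omega) (Nat.add_left_cancel hidx)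
          omega
        simp only [ladderIdx] at hidx
        have hbb : b0 + t + 1 < b' := by
          by_contra hbb
          have := Nat.mul_le_mul_left (ℓ - 1) (show b' - 1 ≤ b0 + t + 1 - 1 by omega)
          omega
        obtain ⟨u, rfl⟩ := Nat.exists_eq_add_of_le hbb.le
        have e3 : b0 + t + 1 + u - 1 = (b0 + t + 1 - 1) + u := by omega
        rw [e3, mul_add] at hidx
        have := hs a' (a - 1) (b0 + t + 1) u hr1 (by omega) (by omega) (by omega) (by omega)
          (by rw [show a - 1 + 1 = a by omega]; omega)
        omega
    · exact hold

theorem star_node {ℓ : ℕ} (hℓ : 2 < ℓ) (lam : YPartition) (h : LadderNode ℓ lam) :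
    Star9 (ℓ - 1) lam.part := by
  unfold LadderNode at h
  induction h with
  | refl => intro a c d t _ _ _ _ h _; simp [emptyP] at h; omega
  | tail _ hstep ih =>
    obtain ⟨i, -, hF⟩ := hstep
    exact star_step hℓ _ _ ih hF

/-- a node of the ladder crystal `B(Λ₀)^L` is smallest in dominance order
in its regularization class. -/
theorem statement9 (ℓ : ℕ) (hℓ : 2 < ℓ) (lam : YPartition)
    (hnode : LadderNode ℓ lam) :
    ∀ mu : YPartition, SameRegClass ℓ lam mu → DomLE lam mu := by
  exact fun mu hc => star_dom hℓ lam mu (star_node hℓ lam hnode) hc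
end
end
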